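/- Petrović's theorem for generalized Riccati equations with at least three denominator roots: let n ≥ 1 and let P, Q ∈ ℂ[z][w] be coprime as polynomials in w over ℂ(z), with deg_w P = n + 2 and deg_w Q = n. If Q, regarded as a polynomial in w over ℂ(z), has at least three pairwise distinct roots in an algebraic closure of ℂ(z), then every single-valued solution of the ODE w′·Q(z,w) = P(z,w) is a rational function. -/

import Mathlib

/-- Evaluation of `P ∈ ℂ[z][w]` (a polynomial in `w` whose coefficients are
polynomials in `z`) at the point `(z, w)`. -/
noncomputable def evZW (P : Polynomial (Polynomial ℂ)) (z w : ℂ) : ℂ :=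
  (P.map (Polynomial.evalRingHom z)).eval w

/-- A weak form of Bloch's theorem. -/
theorem pet_bloch {f : ℂ → ℂ} {c : ℂ} {r : ℝ} (hr : 0 < r)
    (hf : DifferentiableOn ℂ f (Metric.ball c r))
    (hom : ∀ y : ℂ, ∃ p ∈ Metric.ball y 1, p ∉ f '' Metric.ball c r) :
    ‖deriv f c‖ * r ≤ 128 := by
  have hopen : IsOpen (Metric.ball c r) := Metric.isOpen_ball
  have hdf : DifferentiableOn ℂ (deriv f) (Metric.ball c r) := hf.deriv hopen
  have hsub : Metric.closedBall c (r/2) ⊆ Metric.ball c r :=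
    Metric.closedBall_subset_ball (by linarith)
  have hcont : ContinuousOn (fun z => ‖deriv f z‖ * (r/2 - ‖z - c‖)) (Metric.closedBall c (r/2)) := by
    apply ContinuousOn.mul
    · exact (hdf.continuousOn.mono hsub).norm
    · fun_prop
  obtain ⟨z0, hz0, hmax⟩ := (isCompact_closedBall c (r/2)).exists_isMaxOn
    ⟨c, Metric.mem_closedBall_self (by linarith)⟩ hcont
  have hmax' : ∀ z ∈ Metric.closedBall c (r/2), ‖deriv f z‖ * (r/2 - ‖z - c‖) ≤
      ‖deriv f z0‖ * (r/2 - ‖z0 - c‖) := fun z hz => hmax hz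
  set m := ‖deriv f z0‖ with hm
  set ρ := (r/2 - ‖z0 - c‖)/2 with hρ
  have hc := hmax' c (Metric.mem_closedBall_self (by linarith))
  simp only [sub_self, norm_zero, sub_zero] at hc
  by_contra hcon
  push Not at hcon
  have hMpos : 64 < m * (2 * ρ) := by
    have : r/2 - ‖z0 - c‖ = 2 * ρ := by rw [hρ]; ring
    rw [this] at hc
    nlinarith
  have hz0' : ‖z0 - c‖ ≤ r/2 := by simpa [dist_eq_norm] using hz0
  have hρ0 : 0 < ρ := by
    have : 0 ≤ ρ := by rw [hρ]; linarith
    rcases this.eq_or_lt with h | h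
    · rw [← h] at hMpos; linarith
    · exact h
  have hm0 : 0 < m := by
    by_contra h
    nlinarith
  -- bound on derivative in ball z0 ρ
  have hin : ∀ z, ‖z - z0‖ ≤ ρ → z ∈ Metric.closedBall c (r/2) ∧ ‖deriv f z‖ ≤ 2 * m := by
    intro z hz
    have h1 : ‖z - c‖ ≤ ρ + ‖z0 - c‖ := by
      calc ‖z - c‖ = ‖(z - z0) + (z0 - c)‖ := by ring_nf
        _ ≤ _ := (norm_add_le _ _).trans (by linarith)
    have h2 : ρ ≤ r/2 - ‖z - c‖ := by
      have : r/2 - ‖z0 - c‖ = 2 * ρ := by rw [hρ]; ring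
      linarith
    have hzm : z ∈ Metric.closedBall c (r/2) := by
      simp only [Metric.mem_closedBall, dist_eq_norm]; linarith
    refine ⟨hzm, ?_⟩
    have h3 := hmax' z hzm
    have : r/2 - ‖z0 - c‖ = 2 * ρ := by rw [hρ]; ring
    rw [this] at h3
    have h4 : ‖deriv f z‖ * ρ ≤ m * (2 * ρ) :=
      (mul_le_mul_of_nonneg_left h2 (norm_nonneg _)).trans h3
    have : ‖deriv f z‖ * ρ ≤ (2 * m) * ρ := by linarith
    exact le_of_mul_le_mul_right this hρ0
  have hdiffAt : ∀ z, ‖z - z0‖ ≤ ρ → DifferentiableAt ℂ f z := fun z hz =>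
    hf.differentiableAt (hopen.mem_nhds (hsub (hin z hz).1))
  have hdiffAt' : ∀ z, ‖z - z0‖ ≤ ρ → DifferentiableAt ℂ (deriv f) z := fun z hz =>
    hdf.differentiableAt (hopen.mem_nhds (hsub (hin z hz).1))
  -- second derivative
  have h2nd : ∀ z ∈ Metric.closedBall z0 (ρ/2), ‖deriv (deriv f) z‖ ≤ (2 * m)/(ρ/2) := by
    intro z hz
    rw [Metric.mem_closedBall, dist_eq_norm] at hz
    have hball : ∀ y ∈ Metric.closedBall z (ρ/2), ‖y - z0‖ ≤ ρ := by
      intro y hy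
      rw [Metric.mem_closedBall, dist_eq_norm] at hy
      calc ‖y - z0‖ = ‖(y - z) + (z - z0)‖ := by ring_nf
        _ ≤ _ := (norm_add_le _ _).trans (by linarith)
    apply Complex.norm_deriv_le_of_forall_mem_sphere_norm_le (by linarith)
    · apply DifferentiableOn.diffContOnCl
      rw [closure_ball _ (by linarith)]
      intro y hy
      exact (hdiffAt' y (hball y hy)).differentiableWithinAt
    · intro y hy
      exact (hin y (hball y (Metric.sphere_subset_closedBall hy))).2
  have hd1 : ∀ z ∈ Metric.closedBall z0 (ρ/8), ‖deriv f z - deriv f z0‖ ≤ m/2 := by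
    intro z hz
    have h8 : ‖z - z0‖ ≤ ρ/8 := by simpa [dist_eq_norm] using hz
    have := Convex.norm_image_sub_le_of_norm_deriv_le (f := deriv f)
      (s := Metric.closedBall z0 (ρ/2)) (x := z0) (y := z) (C := (2*m)/(ρ/2))
      (fun x hx => hdiffAt' x (by rw [Metric.mem_closedBall, dist_eq_norm] at hx; linarith))
      h2nd (convex_closedBall _ _) (Metric.mem_closedBall_self (by linarith))
      (by rw [Metric.mem_closedBall, dist_eq_norm]; linarith)
    refine this.trans ?_
    calc (2*m)/(ρ/2) * ‖z - z0‖ ≤ (2*m)/(ρ/2) * (ρ/8) := by gcongr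
      _ = m/2 := by field_simp; norm_num
  have hlin : ∀ z ∈ Metric.sphere z0 (ρ/8), m*ρ/16 ≤ ‖f z - f z0‖ := by
    intro z hz
    have hz8 : ‖z - z0‖ = ρ/8 := by simpa [dist_eq_norm] using hz
    have := Convex.norm_image_sub_le_of_norm_hasDerivWithin_le
      (f := fun z => f z - deriv f z0 * z) (f' := fun z => deriv f z - deriv f z0)
      (s := Metric.closedBall z0 (ρ/8)) (x := z0) (y := z) (C := m/2)
      (fun x hx => by
        have h := (hdiffAt x (by rw [Metric.mem_closedBall, dist_eq_norm] at hx; linarith)).hasDerivAt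
        have := h.sub ((hasDerivAt_id x).const_mul (deriv f z0))
        simp only [id, mul_one] at this
        exact this.hasDerivWithinAt)
      hd1 (convex_closedBall _ _) (Metric.mem_closedBall_self (by linarith))
      (Metric.sphere_subset_closedBall hz)
    have e : deriv f z0 * (z - z0) = (f z - f z0) -
      ((f z - deriv f z0 * z) - (f z0 - deriv f z0 * z0)) := by ring
    have e2 : m * (ρ/8) ≤ ‖f z - f z0‖ + m/2 * (ρ/8) := by
      calc m * (ρ/8) = ‖deriv f z0 * (z - z0)‖ := by rw [norm_mul, hz8]
        _ ≤ _ := by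
          rw [e]; refine (norm_sub_le _ _).trans ?_
          rw [hz8] at this
          linarith
    linarith
  have hcover := DiffContOnCl.ball_subset_image_closedBall (f := f) (z₀ := z0) (ε := m*ρ/16)
    (r := ρ/8) (by
      apply DifferentiableOn.diffContOnCl
      rw [closure_ball _ (by linarith)]
      intro y hy
      rw [Metric.mem_closedBall, dist_eq_norm] at hy
      exact (hdiffAt y (by linarith)).differentiableWithinAt) (by linarith) hlin (by
      have h1 : ∀ᶠ z in nhdsWithin z0 {z0}ᶜ, f z ≠ f z0 :=
        (hdiffAt z0 (by simpa using hρ0.le)).hasDerivAt.eventually_ne (by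
          rw [← norm_pos_iff]; exact hm0)
      exact (h1.frequently).filter_mono nhdsWithin_le_nhds)
  obtain ⟨p, hp, hp'⟩ := hom (f z0)
  apply hp'
  have : p ∈ Metric.ball (f z0) (m*ρ/16/2) := Metric.ball_subset_ball (by linarith) hp
  obtain ⟨x, hx, rfl⟩ := hcover this
  refine ⟨x, hsub (hin x ?_).1, rfl⟩
  rw [Metric.mem_closedBall, dist_eq_norm] at hx
  linarith

/-- Holomorphic logarithm on a disc. -/
theorem pet_log {f : ℂ → ℂ} {c : ℂ} {r : ℝ} (hr : 0 < r)
    (hf : DifferentiableOn ℂ f (Metric.ball c r))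
    (h0 : ∀ z ∈ Metric.ball c r, f z ≠ 0) :
    ∃ g : ℂ → ℂ, DifferentiableOn ℂ g (Metric.ball c r) ∧
      ∀ z ∈ Metric.ball c r, Complex.exp (g z) = f z := by
  have hopen : IsOpen (Metric.ball c r) := Metric.isOpen_ball
  have hc : c ∈ Metric.ball c r := Metric.mem_ball_self hr
  have h1 : DifferentiableOn ℂ (fun z => deriv f z / f z) (Metric.ball c r) :=
    (hf.deriv hopen).div hf h0
  obtain ⟨g, hgc, hg⟩ := (h1.isExactOn_ball).with_val_at c (Complex.log (f c))
  refine ⟨g, fun z hz => (hg z hz).differentiableAt.differentiableWithinAt, fun z hz => ?_⟩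
  have hD : ∀ z ∈ Metric.ball c r, HasDerivAt (fun z => f z * Complex.exp (-g z)) 0 z := by
    intro z hz
    have hfz := (hf.differentiableAt (hopen.mem_nhds hz)).hasDerivAt
    have := hfz.mul ((hg z hz).neg.cexp)
    convert! this using 1
    have := h0 z hz
    simp only [Pi.neg_apply]
    field_simp
    ring
  have hconst := IsOpen.is_const_of_deriv_eq_zero hopen (convex_ball c r).isPreconnected
    (f := fun z => f z * Complex.exp (-g z))
    (fun z hz => (hD z hz).differentiableAt.differentiableWithinAt)
    (fun z hz => (hD z hz).deriv) hz hc
  simp only [hgc, Complex.exp_neg, Complex.exp_log (h0 c hc), mul_inv_cancel₀ (h0 c hc)] at hconst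
  have := Complex.exp_ne_zero (g z)
  field_simp at hconst
  exact hconst.symm

/-- Holomorphic inverse cosine on a disc, with control at the centre. -/
theorem pet_arccos {f : ℂ → ℂ} {c : ℂ} {r : ℝ} (hr : 0 < r)
    (hf : DifferentiableOn ℂ f (Metric.ball c r))
    (h1 : ∀ z ∈ Metric.ball c r, f z ≠ 1) (h2 : ∀ z ∈ Metric.ball c r, f z ≠ -1) :
    ∃ g : ℂ → ℂ, DifferentiableOn ℂ g (Metric.ball c r) ∧
      (∀ z ∈ Metric.ball c r, Complex.cos (Real.pi * g z) = f z) ∧ ‖g c‖ ≤ 1 + ‖f c‖ := by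
  have hc : c ∈ Metric.ball c r := Metric.mem_ball_self hr
  obtain ⟨l, hl, hl'⟩ := pet_log (f := fun z => 1 - f z ^ 2) hr (by fun_prop) (by
    intro z hz h
    have : (f z - 1) * (f z + 1) = 0 := by linear_combination -h
    rcases mul_eq_zero.1 this with h | h
    · exact h1 z hz (sub_eq_zero.1 h)
    · exact h2 z hz (eq_neg_of_add_eq_zero_left h))
  set s : ℂ → ℂ := fun z => Complex.exp (l z / 2) with hs
  have hs2 : ∀ z ∈ Metric.ball c r, s z ^ 2 = 1 - f z ^ 2 := by
    intro z hz
    rw [← hl' z hz, hs, ← Complex.exp_nat_mul]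
    congr 1; push_cast; ring
  have hsd : DifferentiableOn ℂ s (Metric.ball c r) := by
    have := hl.div_const 2
    exact this.cexp
  have hI : ∀ z ∈ Metric.ball c r, (f z + Complex.I * s z) * (f z - Complex.I * s z) = 1 := by
    intro z hz
    have := hs2 z hz
    have hI := Complex.I_sq
    linear_combination this - s z ^ 2 * hI
  obtain ⟨u, hu, hu'⟩ := pet_log (f := fun z => f z + Complex.I * s z) hr (by fun_prop) (by
    intro z hz h
    have := hI z hz
    rw [h] at this; simp at this)
  set g0 : ℂ → ℂ := fun z => u z / (Complex.I * Real.pi) with hg0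
  have hpi : (Real.pi : ℂ) ≠ 0 := by exact_mod_cast Real.pi_ne_zero
  have hcos : ∀ z ∈ Metric.ball c r, Complex.cos (Real.pi * g0 z) = f z := by
    intro z hz
    have e1 : (Real.pi : ℂ) * g0 z * Complex.I = u z := by
      rw [hg0]; field_simp
    rw [Complex.cos, e1, show -((Real.pi : ℂ) * g0 z) * Complex.I = - u z by rw [← e1]; ring,
      Complex.exp_neg, hu' z hz]
    have h3 := hI z hz
    have h4 : f z + Complex.I * s z ≠ 0 := fun h => by rw [h] at h3; simp at h3
    rw [inv_eq_of_mul_eq_one_right h3]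
    ring
  set n : ℤ := round ((g0 c).re / 2) with hn
  refine ⟨fun z => g0 z - 2 * n, ?_, ?_, ?_⟩
  · exact (hu.div_const _).sub_const _
  · intro z hz
    rw [← hcos z hz, ← Complex.cos_sub_int_mul_two_pi (Real.pi * g0 z) n]
    congr 1; ring
  · have hcc : Complex.cos (Real.pi * (g0 c - 2 * n)) = f c := by
      rw [← hcos c hc, ← Complex.cos_sub_int_mul_two_pi (Real.pi * g0 c) n]
      congr 1; ring
    set v := g0 c - 2 * n with hv
    have hre : |v.re| ≤ 1 := by
      have := abs_sub_round ((g0 c).re / 2)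
      have e : v.re = 2 * ((g0 c).re / 2 - round ((g0 c).re / 2)) := by
        rw [hv, hn]
        simp only [Complex.sub_re, Complex.mul_re, Complex.re_ofNat, Complex.intCast_re,
          Complex.im_ofNat, Complex.intCast_im]
        ring
      rw [e, abs_mul]
      norm_num
      linarith
    have him : |v.im| ≤ ‖f c‖ := by
      have e := Complex.cos_eq (Real.pi * v)
      rw [hcc] at e
      have hre' : (Real.pi * v).re = Real.pi * v.re := by simp
      have him' : (Real.pi * v).im = Real.pi * v.im := by simp
      rw [hre', him'] at e
      set x := Real.pi * v.re
      set y := Real.pi * v.im with hy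
      have hr1 : (f c).re = Real.cos x * Real.cosh y := by
        rw [e]; simp [← Complex.ofReal_cos, ← Complex.ofReal_sin, ← Complex.ofReal_cosh, ← Complex.ofReal_sinh]
      have hr2 : (f c).im = - (Real.sin x * Real.sinh y) := by
        rw [e]; simp [← Complex.ofReal_cos, ← Complex.ofReal_sin, ← Complex.ofReal_cosh, ← Complex.ofReal_sinh]
      have hsq : ‖f c‖^2 = Real.cos x ^ 2 + Real.sinh y ^ 2 := by
        rw [← Complex.normSq_eq_norm_sq, Complex.normSq_apply, hr1, hr2]
        have a1 := Real.sin_sq_add_cos_sq x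
        have a2 := Real.cosh_sq y
        linear_combination (Real.cos x)^2 * a2 + Real.sinh y ^ 2 * a1
      have h5 : |y| ≤ |Real.sinh y| := by
        rcases le_total 0 y with h | h
        · rw [abs_of_nonneg h]
          exact (Real.self_le_sinh_iff.2 h).trans (le_abs_self _)
        · rw [abs_of_nonpos h]
          have := Real.self_le_sinh_iff.2 (neg_nonneg.2 h)
          rw [Real.sinh_neg] at this
          exact this.trans (neg_le_abs _)
      have h6 : |Real.sinh y| ≤ ‖f c‖ := by
        refine abs_le_of_sq_le_sq ?_ (norm_nonneg _)
        nlinarith [sq_nonneg (Real.cos x)]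
      have h7 : |v.im| ≤ |y| := by
        rw [hy, abs_mul, abs_of_pos Real.pi_pos]
        nlinarith [Real.pi_gt_three, abs_nonneg v.im]
      linarith
    exact (Complex.norm_le_abs_re_add_abs_im v).trans (by linarith)

theorem pet_cosh_int (b : ℝ) : ∃ t : ℝ, |t - b| ≤ 4/5 ∧ ∃ k : ℤ, Real.cosh (Real.pi * t) = k := by
  have key : ∀ b : ℝ, 0 ≤ b → ∃ t : ℝ, |t - b| ≤ 4/5 ∧ ∃ k : ℤ, Real.cosh (Real.pi * t) = k := by
    intro b hb
    have hcont : ContinuousOn (fun t => Real.cosh (Real.pi * t)) (Set.Icc b (b + 4/5)) := by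
      apply Continuous.continuousOn; fun_prop
    have hiv := intermediate_value_Icc (by linarith) hcont
    have hmem : ((⌈Real.cosh (Real.pi * b)⌉ : ℤ) : ℝ) ∈
        Set.Icc (Real.cosh (Real.pi * b)) (Real.cosh (Real.pi * (b + 4/5))) := by
      refine ⟨Int.le_ceil _, (Int.ceil_lt_add_one _).le.trans ?_⟩
      have hpi := Real.pi_gt_three
      have h1 : 2 ≤ Real.cosh (Real.pi * (4/5)) := by
        have := Real.add_one_le_exp (Real.pi * (4/5) / 2)
        have h2 : Real.exp (Real.pi * (4/5)) = Real.exp (Real.pi * (4/5) / 2) ^ 2 := by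
          rw [← Real.exp_nat_mul]; congr 1; push_cast; ring
        have h3 : 4 ≤ Real.exp (Real.pi * (4/5)) := by
          rw [h2]; nlinarith
        rw [Real.cosh_eq]
        have := Real.exp_pos (-(Real.pi * (4/5)))
        linarith
      have h2 := Real.one_le_cosh (Real.pi * b)
      have h3 : 0 ≤ Real.sinh (Real.pi * b) := Real.sinh_nonneg_iff.2 (by positivity)
      have h4 : 0 ≤ Real.sinh (Real.pi * (4/5)) := Real.sinh_nonneg_iff.2 (by positivity)
      rw [mul_add, Real.cosh_add]
      nlinarith [mul_nonneg h3 h4]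
    obtain ⟨t, ht, htk⟩ := hiv hmem
    refine ⟨t, ?_, _, htk⟩
    rw [abs_le]; constructor <;> linarith [ht.1, ht.2]
  rcases le_total 0 b with h | h
  · exact key b h
  · obtain ⟨t, ht, k, hk⟩ := key (-b) (by linarith)
    refine ⟨-t, ?_, k, ?_⟩
    · rw [abs_le] at ht ⊢; constructor <;> linarith [ht.1, ht.2]
    · rw [mul_neg, Real.cosh_neg, hk]

theorem pet_cos_int (k : ℤ) : Complex.cos ((k : ℂ) * Real.pi) = (-1) ^ k := by
  have : ((k : ℂ) * Real.pi) = ((k * Real.pi : ℝ) : ℂ) := by push_cast; ring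
  rw [this, ← Complex.ofReal_cos, Real.cos_int_mul_pi]
  push_cast; ring

theorem pet_sin_int (k : ℤ) : Complex.sin ((k : ℂ) * Real.pi) = 0 := by
  have : ((k : ℂ) * Real.pi) = ((k * Real.pi : ℝ) : ℂ) := by push_cast; ring
  rw [this, ← Complex.ofReal_sin, Real.sin_int_mul_pi]
  simp

theorem pet_net (y : ℂ) : ∃ p ∈ Metric.ball y 1, ∃ k : ℤ, Complex.cos (Real.pi * p) = k := by
  obtain ⟨t, ht, k, hk⟩ := pet_cosh_int y.im
  set n : ℤ := round y.re with hn
  refine ⟨(n : ℂ) + t * Complex.I, ?_, ?_⟩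
  · rw [Metric.mem_ball, dist_eq_norm]
    have h1 := abs_sub_round y.re
    have hsq : ‖((n : ℂ) + t * Complex.I) - y‖^2 = (y.re - n)^2 + (t - y.im)^2 := by
      rw [← Complex.normSq_eq_norm_sq, Complex.normSq_apply]; simp; ring
    have h2 : (y.re - n)^2 ≤ (1/2)^2 := by rw [← hn] at h1; exact sq_le_sq' (abs_le.1 h1).1 (abs_le.1 h1).2
    have h3 : (t - y.im)^2 ≤ (4/5)^2 := sq_le_sq' (abs_le.1 ht).1 (abs_le.1 ht).2
    have := norm_nonneg (((n : ℂ) + t * Complex.I) - y)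
    nlinarith
  · have e : (Real.pi : ℂ) * ((n : ℂ) + t * Complex.I) = ((Real.pi * t : ℝ) : ℂ) * Complex.I + n * Real.pi := by
      push_cast; ring
    rw [e, Complex.cos_add, pet_cos_int, pet_sin_int, mul_zero, sub_zero, mul_comm, Complex.cos_mul_I, ← Complex.ofReal_cosh, hk]
    exact ⟨(-1)^n.natAbs * k, by
      push_cast
      congr 1
      rcases Int.even_or_odd n with h | h
      · rw [h.neg_one_zpow, (Int.natAbs_even.2 h).neg_one_pow]
      · rw [h.neg_one_zpow, (Int.natAbs_odd.2 h).neg_one_pow]⟩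

theorem pet_norm_cos (z : ℂ) : ‖Complex.cos z‖ ≤ Real.exp ‖z‖ := by
  rw [Complex.cos, norm_div]
  have h1 := Complex.norm_exp_le_exp_norm (z * Complex.I)
  have h2 := Complex.norm_exp_le_exp_norm (-z * Complex.I)
  rw [norm_mul, Complex.norm_I, mul_one] at h1 h2
  rw [norm_neg] at h2
  have := norm_add_le (Complex.exp (z * Complex.I)) (Complex.exp (-z * Complex.I))
  rw [Complex.norm_ofNat]
  linarith

/-- Schottky's theorem. -/
theorem pet_schottky : ∃ M : ℝ, ∀ (f : ℂ → ℂ) (c : ℂ) (r : ℝ), 0 < r →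
    DifferentiableOn ℂ f (Metric.ball c r) →
    (∀ z ∈ Metric.ball c r, f z ≠ 0) → (∀ z ∈ Metric.ball c r, f z ≠ 1) → ‖f c‖ ≤ 1 →
    ∀ z ∈ Metric.closedBall c (r/2), ‖f z‖ ≤ M := by
  refine ⟨(1 + Real.exp (Real.pi * Real.exp (Real.pi * 133)))/2, ?_⟩
  intro f c r hr hf h0 h1 hfc z hz
  have hc : c ∈ Metric.ball c r := Metric.mem_ball_self hr
  obtain ⟨F, hF, hF1, hF2⟩ := pet_arccos (f := fun z => 2 * f z - 1) hr (by fun_prop)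
    (fun z hz h => h1 z hz (by linear_combination h/2))
    (fun z hz h => h0 z hz (by linear_combination h/2))
  have hFint : ∀ z ∈ Metric.ball c r, ∀ k : ℤ, F z ≠ k := by
    intro z hz k hk
    have := hF1 z hz
    rw [hk, mul_comm, pet_cos_int] at this
    rcases Int.even_or_odd k with h | h
    · rw [h.neg_one_zpow] at this; exact h1 z hz (by linear_combination -this/2)
    · rw [h.neg_one_zpow] at this; exact h0 z hz (by linear_combination -this/2)
  obtain ⟨G, hG, hG1, hG2⟩ := pet_arccos (f := F) hr hF
    (fun z hz h => hFint z hz 1 (by simpa using h)) (fun z hz h => hFint z hz (-1) (by simpa using h))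
  have hGc : ‖G c‖ ≤ 5 := by
    have : ‖2 * f c - 1‖ ≤ 3 := by
      refine (norm_sub_le _ _).trans ?_
      rw [norm_mul, Complex.norm_ofNat, norm_one]; linarith
    linarith
  have hder : ∀ x ∈ Metric.closedBall c (r/2), ‖deriv G x‖ ≤ 256/r := by
    intro x hx
    have hsub : Metric.ball x (r/2) ⊆ Metric.ball c r := by
      apply Metric.ball_subset_ball'
      rw [Metric.mem_closedBall] at hx; linarith
    have := pet_bloch (f := G) (c := x) (r := r/2) (by linarith) (hG.mono hsub) (by
      intro y
      obtain ⟨p, hp, k, hk⟩ := pet_net y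
      refine ⟨p, hp, ?_⟩
      rintro ⟨u, hu, rfl⟩
      exact hFint u (hsub hu) k (by rw [← hG1 u (hsub hu), hk]))
    rw [le_div_iff₀ hr]; linarith
  have hsub2 : Metric.closedBall c (r/2) ⊆ Metric.ball c r := Metric.closedBall_subset_ball (by linarith)
  have hG3 : ‖G z - G c‖ ≤ 256/r * ‖z - c‖ :=
    Convex.norm_image_sub_le_of_norm_deriv_le (s := Metric.closedBall c (r/2))
      (fun x hx => hG.differentiableAt (Metric.isOpen_ball.mem_nhds (hsub2 hx))) hder
      (convex_closedBall _ _) (Metric.mem_closedBall_self (by linarith)) hz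
  have hG4 : ‖G z‖ ≤ 133 := by
    have hz' : ‖z - c‖ ≤ r/2 := by simpa [dist_eq_norm] using hz
    have : 256/r * ‖z - c‖ ≤ 128 := by
      calc 256/r * ‖z - c‖ ≤ 256/r * (r/2) := by gcongr
        _ = 128 := by field_simp; norm_num
    calc ‖G z‖ = ‖(G z - G c) + G c‖ := by ring_nf
      _ ≤ _ := (norm_add_le _ _).trans (by linarith)
  have hFz : ‖F z‖ ≤ Real.exp (Real.pi * 133) := by
    rw [← hG1 z (hsub2 hz)]
    refine (pet_norm_cos _).trans (Real.exp_le_exp.2 ?_)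
    rw [norm_mul, Complex.norm_real, Real.norm_of_nonneg Real.pi_pos.le]
    gcongr
  have hfz : ‖2 * f z - 1‖ ≤ Real.exp (Real.pi * Real.exp (Real.pi * 133)) := by
    rw [← hF1 z (hsub2 hz)]
    refine (pet_norm_cos _).trans (Real.exp_le_exp.2 ?_)
    rw [norm_mul, Complex.norm_real, Real.norm_of_nonneg Real.pi_pos.le]
    gcongr
  have : ‖2 * f z‖ ≤ 1 + Real.exp (Real.pi * Real.exp (Real.pi * 133)) := by
    calc ‖2 * f z‖ = ‖(2 * f z - 1) + 1‖ := by ring_nf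
      _ ≤ _ := (norm_add_le _ _).trans (by rw [norm_one]; linarith)
  rw [norm_mul, Complex.norm_ofNat] at this
  linarith

/-- Moving a point by a multiple of the period into a bounded strip. -/
theorem pet_translate {f : ℂ → ℂ} {h : ℝ} (hh : 0 < h) (hper : Function.Periodic f (h : ℂ))
    (τ : ℂ) (x : ℝ) : ∃ σ : ℂ, f σ = f τ ∧ σ.im = τ.im ∧ x ≤ σ.re ∧ σ.re ≤ x + h := by
  set n : ℤ := ⌊(τ.re - x)/h⌋ with hn
  refine ⟨τ + ((-n : ℤ) : ℂ) * h, hper.int_mul (-n) τ, by simp, ?_, ?_⟩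
  · have := Int.floor_le ((τ.re - x)/h)
    rw [← hn, le_div_iff₀ hh] at this
    simp; linarith
  · have := Int.lt_floor_add_one ((τ.re - x)/h)
    rw [← hn, div_lt_iff₀ hh] at this
    simp; linarith

theorem pet_dichotomy {f : ℂ → ℂ} {Y h : ℝ} (hh : 0 < h)
    (hf : ∀ τ : ℂ, Y < τ.im → DifferentiableAt ℂ f τ)
    (h0 : ∀ τ : ℂ, Y < τ.im → f τ ≠ 0) (h1 : ∀ τ : ℂ, Y < τ.im → f τ ≠ 1)
    (hper : Function.Periodic f (h : ℂ)) :
    ∃ Y' : ℝ, Y ≤ Y' ∧ ∃ M : ℝ, (∀ τ : ℂ, Y' < τ.im → ‖f τ‖ ≤ M) ∨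
      (∀ τ : ℂ, Y' < τ.im → 1 ≤ ‖f τ‖) := by
  by_cases H : ∃ Y' : ℝ, Y ≤ Y' ∧ ∀ τ : ℂ, Y' < τ.im → 1 ≤ ‖f τ‖
  · obtain ⟨Y', hY', H⟩ := H
    exact ⟨Y', hY', 0, Or.inr H⟩
  push Not at H
  obtain ⟨M, hM⟩ := pet_schottky
  have hline : ∀ τ0 : ℂ, Y + 2 * h ≤ τ0.im → ‖f τ0‖ < 1 → ∀ τ : ℂ, τ.im = τ0.im → ‖f τ‖ ≤ M := by
    intro τ0 him hlt τ hτ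
    obtain ⟨σ, hσ1, hσ2, hσ3, hσ4⟩ := pet_translate hh hper τ τ0.re
    rw [← hσ1]
    have hball : ∀ z ∈ Metric.ball τ0 (τ0.im - Y), Y < z.im := by
      intro z hz
      rw [Metric.mem_ball, dist_eq_norm] at hz
      have := (Complex.abs_im_le_norm (z - τ0)).trans_lt hz
      rw [Complex.sub_im] at this
      have := (abs_lt.1 this).1
      linarith
    apply hM f τ0 (τ0.im - Y) (by linarith)
      (fun z hz => (hf z (hball z hz)).differentiableWithinAt)
      (fun z hz => h0 z (hball z hz)) (fun z hz => h1 z (hball z hz)) hlt.le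
    rw [Metric.mem_closedBall, dist_eq_norm]
    refine (Complex.norm_le_abs_re_add_abs_im _).trans ?_
    rw [Complex.sub_re, Complex.sub_im, hσ2, hτ, sub_self, abs_zero, add_zero, abs_of_nonneg (by linarith)]
    linarith
  obtain ⟨τ1, hτ1, hlt1⟩ := H (Y + 2 * h) (by linarith)
  refine ⟨τ1.im, by linarith, M, Or.inl ?_⟩
  intro τ hτ
  obtain ⟨τ2, hτ2, hlt2⟩ := H τ.im (by linarith)
  have hcl : closure (Complex.im ⁻¹' Set.Ioo τ1.im τ2.im) ⊆ Complex.im ⁻¹' Set.Icc τ1.im τ2.im :=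
    closure_minimal (Set.preimage_mono Set.Ioo_subset_Icc_self)
      (isClosed_Icc.preimage Complex.continuous_im)
  have hcontOn : ContinuousOn f (Complex.im ⁻¹' Set.Icc τ1.im τ2.im) := fun z hz =>
    (hf z (by have := hz.1; linarith)).continuousAt.continuousWithinAt
  obtain ⟨K, hK⟩ : ∃ K : ℝ, ∀ z : ℂ, z.im ∈ Set.Icc τ1.im τ2.im → ‖f z‖ ≤ K := by
    have hcomp : IsCompact (Set.Icc (0:ℝ) h ×ℂ Set.Icc τ1.im τ2.im) :=
      isCompact_Icc.reProdIm isCompact_Icc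
    obtain ⟨K, hK⟩ := hcomp.exists_bound_of_continuousOn (f := f) (hcontOn.mono (fun z hz => hz.2))
    refine ⟨K, fun z hz => ?_⟩
    obtain ⟨σ, hσ1, hσ2, hσ3, hσ4⟩ := pet_translate hh hper z 0
    rw [← hσ1]
    apply hK
    rw [Complex.mem_reProdIm, hσ2]
    exact ⟨⟨hσ3, by linarith⟩, hz⟩
  refine PhragmenLindelof.horizontal_strip (a := τ1.im) (b := τ2.im) (f := f) ?_ ?_
    (hline τ1 (by linarith) hlt1) (hline τ2 (by linarith) hlt2) hτ.le hτ2.le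
  · refine ⟨fun z hz => (hf z (by have := hz.1; linarith)).differentiableWithinAt, ?_⟩
    exact hcontOn.mono hcl
  · refine ⟨0, div_pos Real.pi_pos (by linarith), 0, ?_⟩
    refine Asymptotics.IsBigO.of_bound K ?_
    apply Filter.mem_inf_of_right
    rw [Filter.mem_principal]
    intro z hz
    simpa using hK z (Set.Ioo_subset_Icc_self hz)

open Function.Periodic in
/-- Periodic holomorphic functions of moderate growth near `i∞` are meromorphic in `q`. -/
theorem pet_cusp {g : ℂ → ℂ} {Y C : ℝ} {h N : ℕ} (hh : 0 < h)
    (hper : Function.Periodic g ((h : ℝ) : ℂ))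
    (hg : ∀ τ : ℂ, Y < τ.im → DifferentiableAt ℂ g τ)
    (hb : ∀ τ : ℂ, Y < τ.im → ‖g τ‖ ≤ C * Real.exp (2 * Real.pi * N * τ.im)) :
    ∃ G : ℂ → ℂ, MeromorphicAt G 0 ∧ ∀ τ, G (qParam h τ) = g τ := by
  have hh' : (0:ℝ) < h := by exact_mod_cast hh
  set g1 : ℂ → ℂ := fun τ => g τ * qParam h τ ^ (h * N) with hg1
  have hqper : Function.Periodic (qParam (h:ℝ)) ((h : ℝ) : ℂ) := by
    intro τ
    unfold qParam
    have : (((h:ℝ)):ℂ) ≠ 0 := by exact_mod_cast hh'.ne'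
    rw [show 2 * (Real.pi : ℂ) * Complex.I * (τ + (h:ℝ)) / (h:ℝ) =
      2 * (Real.pi : ℂ) * Complex.I * τ / (h:ℝ) + 2 * Real.pi * Complex.I by field_simp]
    rw [Complex.exp_add, Complex.exp_two_pi_mul_I, mul_one]
  have hper1 : Function.Periodic g1 ((h : ℝ) : ℂ) := by
    intro τ
    simp only [hg1]
    rw [hper τ, hqper τ]
  have hmem : {τ : ℂ | Y < τ.im} ∈ Filter.comap Complex.im Filter.atTop :=
    Filter.preimage_mem_comap (Filter.Ioi_mem_atTop Y)
  have hd1 : ∀ᶠ τ in Filter.comap Complex.im Filter.atTop, DifferentiableAt ℂ g1 τ := by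
    filter_upwards [hmem] with τ hτ
    exact (hg τ hτ).mul ((differentiable_qParam τ).pow _)
  have hb1 : Filter.BoundedAtFilter (Filter.comap Complex.im Filter.atTop) g1 := by
    refine Asymptotics.IsBigO.of_bound C ?_
    filter_upwards [hmem] with τ hτ
    simp only [hg1, norm_mul, norm_pow, norm_qParam, Pi.one_apply, norm_one, mul_one]
    rw [← Real.exp_nat_mul]
    calc ‖g τ‖ * _ ≤ (C * Real.exp (2 * Real.pi * N * τ.im)) * _ :=
          mul_le_mul_of_nonneg_right (hb τ hτ) (Real.exp_pos _).le
      _ = C := by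
        rw [mul_assoc, ← Real.exp_add]
        have : 2 * Real.pi * N * τ.im + ((h * N : ℕ) : ℝ) * (-2 * Real.pi * τ.im / h) = 0 := by
          push_cast; field_simp; ring
        rw [this, Real.exp_zero, mul_one]
  have hmer : MeromorphicAt (cuspFunction h g1) 0 := by
    have e0 := differentiableAt_cuspFunction_zero hh' hper1 hd1 hb1
    have e1 := eventually_differentiableAt_cuspFunction_nhds_ne_zero hh' hper1 hd1
    have : AnalyticAt ℂ (cuspFunction h g1) 0 :=
      Complex.analyticAt_of_differentiable_on_punctured_nhds_of_continuousAt e1 e0.continuousAt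
    exact this.meromorphicAt
  refine ⟨fun q => cuspFunction h g1 q / q ^ (h * N), hmer.div ((MeromorphicAt.id 0).pow _), ?_⟩
  intro τ
  simp only
  rw [eq_cuspFunction hh'.ne' hper1 τ]
  simp only [hg1]
  rw [mul_div_cancel_right₀]
  exact pow_ne_zero _ (qParam_ne_zero _)

/-- The coordinate `z = exp (-2πiτ)`. -/
noncomputable def petE (τ : ℂ) : ℂ := Complex.exp (-(2 * Real.pi * Complex.I * τ))

theorem pet_E_norm (τ : ℂ) : ‖petE τ‖ = Real.exp (2 * Real.pi * τ.im) := by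
  rw [petE, Complex.norm_exp]
  congr 1
  simp [Complex.mul_re, Complex.mul_im]

theorem pet_E_per (τ : ℂ) (k : ℕ) : petE (τ + k) = petE τ := by
  unfold petE
  rw [Complex.exp_eq_exp_iff_exists_int]
  exact ⟨-k, by push_cast; ring⟩

theorem pet_ev_sum (P : Polynomial (Polynomial ℂ)) (z w : ℂ) :
    evZW P z w = ∑ i ∈ Finset.range (P.natDegree + 1), (P.coeff i).eval z * w ^ i := by
  unfold evZW
  rw [Polynomial.eval_map, Polynomial.eval₂_eq_sum_range]
  rfl

theorem pet_rootbound {p : Polynomial ℂ} {M M' : ℝ} (hp : p.Monic) (hd : 1 ≤ p.natDegree)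
    (hM : ∀ i < p.natDegree, ‖p.coeff i‖ ≤ M) {x : ℂ} (hx : ‖p.eval x‖ ≤ M') :
    ‖x‖ ≤ M + M' + 1 := by
  set v := p.eval x with hv
  have hdeg : (Polynomial.C v).degree < p.degree := by
    refine lt_of_le_of_lt Polynomial.degree_C_le ?_
    exact Polynomial.natDegree_pos_iff_degree_pos.mp hd
  have hm : (p - Polynomial.C v).Monic := hp.sub_of_left hdeg
  have hnd : (p - Polynomial.C v).natDegree = p.natDegree := by
    rw [Polynomial.natDegree_sub_C]
  have hroot : (p - Polynomial.C v).IsRoot x := by simp [hv]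
  have h := Polynomial.IsRoot.norm_lt_cauchyBound hm.ne_zero hroot
  have hMM : 0 ≤ M := le_trans (norm_nonneg _) (hM 0 (by omega))
  have hM'0 : 0 ≤ M' := le_trans (norm_nonneg _) hx
  have h2 : Polynomial.cauchyBound (p - Polynomial.C v) ≤ NNReal.mk (M + M') (by positivity) + 1 := by
    unfold Polynomial.cauchyBound
    rw [hm.leadingCoeff, hnd]
    simp only [nnnorm_one, div_one]
    gcongr
    apply Finset.sup_le
    intro i hi
    rw [← NNReal.coe_le_coe]
    simp only [coe_nnnorm, NNReal.coe_mk, Polynomial.coeff_sub]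
    have h1 := hM i (by simpa using hi)
    refine (norm_sub_le _ _).trans ?_
    rw [Polynomial.coeff_C]
    split_ifs
    · linarith
    · simp; linarith
  have h3 := (h.le.trans h2)
  rw [← NNReal.coe_le_coe] at h3
  simpa using h3

/-- The map whose lifts are the root functions. -/
noncomputable def petMap (q : Polynomial (Polynomial ℂ)) (x : ℂ × ℂ) : ℂ × ℂ :=
  (x.1, evZW q (petE x.1) x.2)

theorem pet_contDiff (q : Polynomial (Polynomial ℂ)) :
    ContDiff ℂ 1 (fun x : ℂ × ℂ => evZW q (petE x.1) x.2) := by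
  simp only [pet_ev_sum, petE]
  apply ContDiff.sum
  intro i _
  apply ContDiff.mul
  · simp only [Polynomial.eval_eq_sum_range]
    fun_prop
  · fun_prop

theorem pet_proper (q : Polynomial (Polynomial ℂ)) (hq : q.Monic) (hd : 1 ≤ q.natDegree) :
    IsProperMap (petMap q) := by
  rw [isProperMap_iff_isCompact_preimage]
  have hc : Continuous (petMap q) := by
    unfold petMap
    exact continuous_fst.prodMk (pet_contDiff q).continuous
  refine ⟨hc, fun K hK => ?_⟩
  apply Metric.isCompact_of_isClosed_isBounded (hK.isClosed.preimage hc)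
  obtain ⟨R, hR⟩ := hK.isBounded.exists_norm_le
  have hbd : ∃ M : ℝ, ∀ τ : ℂ, ‖τ‖ ≤ R → ∀ i < q.natDegree, ‖(q.coeff i).eval (petE τ)‖ ≤ M := by
    have h1 : ∀ i, ∃ M : ℝ, ∀ τ : ℂ, ‖τ‖ ≤ R → ‖(q.coeff i).eval (petE τ)‖ ≤ M := by
      intro i
      have hcont : Continuous (fun τ : ℂ => (q.coeff i).eval (petE τ)) := by
        unfold petE; fun_prop
      obtain ⟨M, hM⟩ := (isCompact_closedBall (0:ℂ) R).exists_bound_of_continuousOn hcont.continuousOn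
      exact ⟨M, fun τ hτ => hM τ (by simpa using hτ)⟩
    choose M hM using h1
    refine ⟨∑ i ∈ Finset.range q.natDegree, |M i|, fun τ hτ i hi => ?_⟩
    refine (hM i τ hτ).trans ((le_abs_self _).trans ?_)
    exact Finset.single_le_sum (f := fun i => |M i|) (fun i _ => abs_nonneg _) (by simpa using hi)
  obtain ⟨M, hM⟩ := hbd
  rw [isBounded_iff_forall_norm_le]
  refine ⟨max R (M + R + 1), fun x hx => ?_⟩
  have hx' := hR _ hx
  rw [petMap, Prod.norm_def, sup_le_iff] at hx'
  rw [Prod.norm_def]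
  apply max_le_max hx'.1
  have hm : (q.map (Polynomial.evalRingHom (petE x.1))).Monic := hq.map _
  have hnd : (q.map (Polynomial.evalRingHom (petE x.1))).natDegree = q.natDegree := hq.natDegree_map _
  apply pet_rootbound hm (by omega) _ hx'.2
  intro i hi
  rw [hnd] at hi
  simpa using hM x.1 hx'.1 i hi

theorem pet_strict (q : Polynomial (Polynomial ℂ)) (x : ℂ × ℂ)
    (hx : evZW q.derivative (petE x.1) x.2 ≠ 0) :
    ∃ f' : (ℂ × ℂ) ≃L[ℂ] (ℂ × ℂ), HasStrictFDerivAt (petMap q) (f' : (ℂ × ℂ) →L[ℂ] (ℂ × ℂ)) x := by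
  have h1 : HasStrictFDerivAt (fun x : ℂ × ℂ => evZW q (petE x.1) x.2)
      (fderiv ℂ (fun x : ℂ × ℂ => evZW q (petE x.1) x.2) x) x :=
    (pet_contDiff q).contDiffAt.hasStrictFDerivAt (by norm_num)
  set L := fderiv ℂ (fun x : ℂ × ℂ => evZW q (petE x.1) x.2) x with hL
  have hv : L (0, 1) = evZW q.derivative (petE x.1) x.2 := by
    have h2 : HasDerivAt (fun w : ℂ => evZW q (petE x.1) w) (L (0,1)) x.2 := by
      have h3 : HasDerivAt (fun w : ℂ => (x.1, w)) ((0:ℂ), (1:ℂ)) x.2 :=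
        (hasDerivAt_const _ _).prodMk (hasDerivAt_id _)
      have := (h1.hasFDerivAt).comp_hasDerivAt (f := fun w : ℂ => (x.1, w)) x.2 h3
      exact this
    have h4 : HasDerivAt (fun w : ℂ => evZW q (petE x.1) w)
        (evZW q.derivative (petE x.1) x.2) x.2 := by
      unfold evZW
      rw [← Polynomial.derivative_map]
      exact Polynomial.hasDerivAt _ _
    exact h2.unique h4
  rw [← hv] at hx
  have hLs : ∀ y : ℂ × ℂ, L y = L (1,0) * y.1 + L (0,1) * y.2 := by
    intro y
    have : y = y.1 • ((1:ℂ),(0:ℂ)) + y.2 • ((0:ℂ),(1:ℂ)) := by ext <;> simp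
    conv_lhs => rw [this]
    rw [map_add, map_smul, map_smul]; simp; ring
  have h5 : HasStrictFDerivAt (petMap q) ((ContinuousLinearMap.fst ℂ ℂ ℂ).prod L) x :=
    hasStrictFDerivAt_fst.prodMk h1
  let f' : (ℂ × ℂ) ≃L[ℂ] (ℂ × ℂ) := ContinuousLinearEquiv.equivOfInverse
    ((ContinuousLinearMap.fst ℂ ℂ ℂ).prod L)
    ((ContinuousLinearMap.fst ℂ ℂ ℂ).prod ((L (0,1))⁻¹ • (ContinuousLinearMap.snd ℂ ℂ ℂ) -
      ((L (0,1))⁻¹ * L (1,0)) • (ContinuousLinearMap.fst ℂ ℂ ℂ)))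
    (by
      intro y
      ext
      · simp
      · simp [hLs y]; field_simp; ring)
    (by
      intro y
      ext
      · simp
      · simp [hLs (y.1, _)]; field_simp; ring)
  exact ⟨f', h5⟩

theorem pet_diff (q : Polynomial (Polynomial ℂ)) {Y : ℝ}
    (hs : ∀ τ : ℂ, Y < τ.im → ∀ w, evZW q (petE τ) w = 0 → evZW q.derivative (petE τ) w ≠ 0)
    {a : ℂ → ℂ} (ha : ContinuousOn a {τ | Y < τ.im})
    (hroot : ∀ τ : ℂ, Y < τ.im → evZW q (petE τ) (a τ) = 0) (τ : ℂ) (hτ : Y < τ.im) :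
    DifferentiableAt ℂ a τ := by
  have hopen : IsOpen {τ : ℂ | Y < τ.im} := isOpen_lt continuous_const Complex.continuous_im
  have hnh : {τ : ℂ | Y < τ.im} ∈ nhds τ := hopen.mem_nhds hτ
  have hca : ContinuousAt a τ := ha.continuousAt hnh
  obtain ⟨f', hf'⟩ := pet_strict q (τ, a τ) (hs τ hτ _ (hroot τ hτ))
  have h1 := hf'.to_localInverse
  have h2 := hf'.eventually_left_inverse
  have hpt : petMap q (τ, a τ) = (τ, 0) := by simp [petMap, hroot τ hτ]
  rw [hpt] at h1
  have h3 : ∀ᶠ t in nhds τ, hf'.localInverse (petMap q) f' (τ, a τ) (petMap q (t, a t)) = (t, a t) := by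
    have : ContinuousAt (fun t => (t, a t)) τ := continuousAt_id.prodMk hca
    exact this.eventually h2
  have h4 : DifferentiableAt ℂ (fun t : ℂ => (hf'.localInverse (petMap q) f' (τ, a τ) (t, 0)).2) τ := by
    have h5 : DifferentiableAt ℂ (fun t : ℂ => (t, (0:ℂ))) τ := by fun_prop
    have := (h1.hasFDerivAt.differentiableAt).comp (f := fun t : ℂ => (t, (0:ℂ))) τ h5
    exact this.snd
  refine h4.congr_of_eventuallyEq ?_
  filter_upwards [h3, hnh] with t ht ht2
  have : petMap q (t, a t) = (t, 0) := by simp [petMap, hroot t ht2]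
  rw [this] at ht
  rw [ht]

theorem pet_lift (q : Polynomial (Polynomial ℂ)) (hq : q.Monic) (hd : 1 ≤ q.natDegree) {Y : ℝ}
    (hs : ∀ τ : ℂ, Y < τ.im → ∀ w, evZW q (petE τ) w = 0 → evZW q.derivative (petE τ) w ≠ 0)
    (τ₀ w₀ : ℂ) (hτ₀ : Y < τ₀.im) (hw₀ : evZW q (petE τ₀) w₀ = 0) :
    ∃ a : ℂ → ℂ, ContinuousOn a {τ | Y < τ.im} ∧
      (∀ τ : ℂ, Y < τ.im → evZW q (petE τ) (a τ) = 0) ∧ a τ₀ = w₀ ∧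
      ∀ b : ℂ → ℂ, ContinuousOn b {τ | Y < τ.im} →
      (∀ τ : ℂ, Y < τ.im → evZW q (petE τ) (b τ) = 0) → b τ₀ = w₀ → ∀ τ : ℂ, Y < τ.im → a τ = b τ := by
  classical
  set H : Set ℂ := {τ | Y < τ.im} with hH
  have hopen : IsOpen H := isOpen_lt continuous_const Complex.continuous_im
  have hconv : Convex ℝ H := convex_halfSpace_im_gt Y
  have : ContractibleSpace H := hconv.contractibleSpace ⟨τ₀, hτ₀⟩
  have : LocallyPathConnectedSpace H := hopen.locallyPathConnectedSpace
  set s : Set (ℂ × ℂ) := {x | Y < x.1.im ∧ x.2 = 0} with hsdef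
  have hcov : IsCoveringMapOn (petMap q) s := by
    apply (pet_proper q hq hd).isClosedMap.isCoveringMapOn_of_isLocalHomeomorphOn
    · intro x hx
      have hm : (q.map (Polynomial.evalRingHom (petE x.1))) ≠ 0 := (hq.map _).ne_zero
      apply Set.Finite.subset (((q.map (Polynomial.evalRingHom (petE x.1))).roots.toFinset.finite_toSet).image
        (fun w => (x.1, w)))
      intro y hy
      have hy' : petMap q y = x := hy
      have h1 : y.1 = x.1 := by rw [← hy']; rfl
      have h2 : evZW q (petE y.1) y.2 = 0 := by
        have : (petMap q y).2 = 0 := by rw [hy']; exact hx.2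
        exact this
      refine ⟨y.2, ?_, by rw [← h1]⟩
      rw [h1] at h2
      simp only [Finset.mem_coe, Multiset.mem_toFinset, Polynomial.mem_roots hm]
      exact h2
    · intro x hx
      have hx' : petMap q x ∈ s := hx
      obtain ⟨f', hf'⟩ := pet_strict q x (hs x.1 hx'.1 _ hx'.2)
      exact ⟨hf'.toOpenPartialHomeomorph (petMap q), hf'.mem_toOpenPartialHomeomorph_source, rfl⟩
  let f : C(H, ℂ × ℂ) := ⟨fun t => ((t : ℂ), 0), by fun_prop⟩
  obtain ⟨F, ⟨hF0, hF⟩, huniq⟩ := hcov.existsUnique_continuousMap_lifts f (a₀ := ⟨τ₀, hτ₀⟩)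
    (e₀ := (τ₀, w₀)) (by simp [petMap, f, hw₀]) (fun t => ⟨t.2, rfl⟩)
  have hFt : ∀ t : H, (F t).1 = t ∧ evZW q (petE t) (F t).2 = 0 := by
    intro t
    have h1 := congrFun hF t
    simp only [Function.comp_apply, petMap, f, ContinuousMap.coe_mk, Prod.mk.injEq] at h1
    exact ⟨h1.1, by rw [← h1.1]; exact h1.2⟩
  refine ⟨fun t => if h : t ∈ H then (F ⟨t, h⟩).2 else 0, ?_, ?_, ?_, ?_⟩
  · rw [continuousOn_iff_continuous_domRestrict]
    have : H.domRestrict (fun t => if h : t ∈ H then (F ⟨t, h⟩).2 else 0) = fun t => (F t).2 := by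
      ext t; simp [Set.domRestrict]
    rw [this]
    fun_prop
  · intro τ hτ
    have : τ ∈ H := hτ
    simp only [this, dif_pos]
    exact (hFt ⟨τ, hτ⟩).2
  · have : τ₀ ∈ H := hτ₀
    simp only [this, dif_pos]
    rw [hF0]
  · intro b hb hbr hb0 τ hτ
    have hmem : τ ∈ H := hτ
    simp only [hmem, dif_pos]
    rw [continuousOn_iff_continuous_domRestrict] at hb
    let G : C(H, ℂ × ℂ) := ⟨fun t => ((t : ℂ), b t), continuous_subtype_val.prodMk hb⟩
    have := huniq G ⟨by simp [G, hb0], by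
      ext t
      · simp [G, petMap, f]
      · simp [G, petMap, f, hbr t t.2]⟩
    rw [← this]
    rfl

theorem pet_poly_growth (p : Polynomial ℂ) : ∃ C : ℝ, 0 ≤ C ∧ ∃ N : ℕ, ∀ z : ℂ, 1 ≤ ‖z‖ →
    ‖p.eval z‖ ≤ C * ‖z‖ ^ N := by
  refine ⟨∑ i ∈ Finset.range (p.natDegree + 1), ‖p.coeff i‖, by positivity, p.natDegree, fun z hz => ?_⟩
  rw [Polynomial.eval_eq_sum_range, Finset.sum_mul]
  refine (norm_sum_le _ _).trans (Finset.sum_le_sum fun i hi => ?_)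
  rw [norm_mul, norm_pow]
  gcongr
  simpa [Nat.lt_succ_iff] using hi

theorem pet_growth (q : Polynomial (Polynomial ℂ)) (hq : q.Monic) (hd : 1 ≤ q.natDegree) :
    ∃ C : ℝ, ∃ N : ℕ, ∀ z w : ℂ, 1 ≤ ‖z‖ → evZW q z w = 0 → ‖w‖ ≤ C * ‖z‖ ^ N := by
  choose C hC N hN using pet_poly_growth
  set C' := ∑ i ∈ Finset.range q.natDegree, C (q.coeff i)
  set N' := ∑ i ∈ Finset.range q.natDegree, N (q.coeff i)
  refine ⟨C' + 1, N', fun z w hz hw => ?_⟩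
  have hm : (q.map (Polynomial.evalRingHom z)).Monic := hq.map _
  have hnd : (q.map (Polynomial.evalRingHom z)).natDegree = q.natDegree := hq.natDegree_map _
  have h := pet_rootbound (M := C' * ‖z‖ ^ N') (M' := 0) (x := w) hm (by omega) (fun i hi => ?_)
    (by have : Polynomial.eval w (q.map (Polynomial.evalRingHom z)) = 0 := hw
        simp [this])
  · have : 1 ≤ ‖z‖ ^ N' := one_le_pow₀ hz
    linarith
  · rw [hnd] at hi
    rw [Polynomial.coeff_map]
    refine (hN (q.coeff i) z hz).trans ?_
    have hi' : i ∈ Finset.range q.natDegree := by simpa using hi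
    gcongr
    · exact Finset.sum_nonneg fun i _ => hC _
    · exact Finset.single_le_sum (f := fun i => C (q.coeff i)) (fun i _ => hC _) hi'
    · exact Finset.single_le_sum (f := fun i => N (q.coeff i)) (fun i _ => Nat.zero_le _) hi'

/-- `a` is a periodic holomorphic branch of the roots of `q`. -/
def PetBranch (q : Polynomial (Polynomial ℂ)) (Y : ℝ) (h : ℕ) (a : ℂ → ℂ) : Prop :=
  Function.Periodic a ((h : ℝ) : ℂ) ∧ (∀ τ, Y < τ.im → DifferentiableAt ℂ a τ) ∧
    ∀ τ, Y < τ.im → evZW q (petE τ) (a τ) = 0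

theorem pet_branch (q : Polynomial (Polynomial ℂ)) (hq : q.Monic) (hd : 1 ≤ q.natDegree) {Y : ℝ}
    (hs : ∀ τ : ℂ, Y < τ.im → ∀ w, evZW q (petE τ) w = 0 → evZW q.derivative (petE τ) w ≠ 0)
    (τ₀ w₀ : ℂ) (hτ₀ : Y < τ₀.im) (hw₀ : evZW q (petE τ₀) w₀ = 0) :
    ∃ a : ℂ → ℂ, ∃ h : ℕ, 0 < h ∧ PetBranch q Y h a ∧ a τ₀ = w₀ := by
  classical
  obtain ⟨a, hac, har, ha0, -⟩ := pet_lift q hq hd hs τ₀ w₀ hτ₀ hw₀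
  have him : ∀ (τ : ℂ) (k : ℕ), (τ + k).im = τ.im := fun τ k => by simp
  have hk1 : ∀ k : ℕ, ContinuousOn (fun τ => a (τ + k)) {τ | Y < τ.im} := by
    intro k
    apply hac.comp (by fun_prop)
    intro τ hτ
    simpa using hτ
  have hk2 : ∀ k : ℕ, ∀ τ : ℂ, Y < τ.im → evZW q (petE τ) (a (τ + k)) = 0 := by
    intro k τ hτ
    have := har (τ + k) (by rw [him]; exact hτ)
    rwa [pet_E_per] at this
  have hm : (q.map (Polynomial.evalRingHom (petE τ₀))) ≠ 0 := (hq.map _).ne_zero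
  obtain ⟨i, j, hij, hv⟩ : ∃ i j : ℕ, i < j ∧ a (τ₀ + i) = a (τ₀ + j) := by
    let f : ℕ → (q.map (Polynomial.evalRingHom (petE τ₀))).roots.toFinset := fun k =>
      ⟨a (τ₀ + k), by
        rw [Multiset.mem_toFinset, Polynomial.mem_roots hm]
        exact hk2 k τ₀ hτ₀⟩
    obtain ⟨i, j, hne, hfij⟩ := Finite.exists_ne_map_eq_of_infinite f
    have hfij' : a (τ₀ + i) = a (τ₀ + j) := congrArg Subtype.val hfij
    rcases lt_or_gt_of_ne hne with h | h
    · exact ⟨i, j, h, hfij'⟩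
    · exact ⟨j, i, h, hfij'.symm⟩
  obtain ⟨g, -, -, -, hg⟩ := pet_lift q hq hd hs τ₀ (a (τ₀ + i)) hτ₀ (hk2 i τ₀ hτ₀)
  have hper : ∀ τ : ℂ, Y < τ.im → a (τ + (j - i : ℕ)) = a τ := by
    intro τ hτ
    have him' : Y < (τ - i).im := by simpa using hτ
    have h1 := hg _ (hk1 i) (hk2 i) rfl (τ - i) him'
    have h2 := hg _ (hk1 j) (hk2 j) hv.symm (τ - i) him'
    have h3 := h1.symm.trans h2
    simp only [sub_add_cancel] at h3
    rw [h3]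
    congr 1
    push_cast [hij.le]
    ring
  have hopen : IsOpen {τ : ℂ | Y < τ.im} := isOpen_lt continuous_const Complex.continuous_im
  refine ⟨fun τ => if Y < τ.im then a τ else 0, j - i, by omega, ⟨?_, ?_, ?_⟩, by simp [hτ₀, ha0]⟩
  · intro τ
    have := him τ (j - i)
    simp only [Complex.ofReal_natCast]
    rw [this]
    split_ifs with h
    · exact hper τ h
    · rfl
  · intro τ hτ
    refine (pet_diff q hs hac har τ hτ).congr_of_eventuallyEq ?_
    filter_upwards [hopen.mem_nhds hτ] with t ht
    have : Y < t.im := ht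
    simp [this]
  · intro τ hτ
    simp [hτ, har τ hτ]

theorem pet_three (p : Polynomial ℂ) (hd : 3 ≤ p.natDegree)
    (hs : ∀ w, p.eval w = 0 → p.derivative.eval w ≠ 0) :
    ∃ a b c, p.eval a = 0 ∧ p.eval b = 0 ∧ p.eval c = 0 ∧ a ≠ b ∧ a ≠ c ∧ b ≠ c := by
  classical
  have hp : p ≠ 0 := by rintro rfl; simp at hd
  have hnd : p.roots.Nodup := by
    rw [Multiset.nodup_iff_count_le_one]
    intro w
    by_contra! h
    rw [Polynomial.count_roots, Polynomial.one_lt_rootMultiplicity_iff_isRoot hp] at h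
    exact hs w h.1 h.2
  have hcard : p.roots.card = p.natDegree := by
    exact (Polynomial.splits_iff_card_roots.mp (IsAlgClosed.splits p))
  have h3 : 2 < p.roots.toFinset.card := by
    rw [Multiset.toFinset_card_of_nodup hnd]; omega
  obtain ⟨a, ha, b, hb, c, hc, h⟩ := Finset.two_lt_card.mp h3
  simp only [Multiset.mem_toFinset, Polynomial.mem_roots hp] at ha hb hc
  exact ⟨a, b, c, ha, hb, hc, h⟩

theorem pet_distinct (q : Polynomial (Polynomial ℂ)) (hq : q.Monic) (hd : 1 ≤ q.natDegree) {Y : ℝ}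
    (hs : ∀ τ : ℂ, Y < τ.im → ∀ w, evZW q (petE τ) w = 0 → evZW q.derivative (petE τ) w ≠ 0)
    {a b : ℂ → ℂ} {h k : ℕ} (ha : PetBranch q Y h a) (hb : PetBranch q Y k b)
    {τ₀ : ℂ} (hτ₀ : Y < τ₀.im) (hab : a τ₀ ≠ b τ₀) (τ : ℂ) (hτ : Y < τ.im) : a τ ≠ b τ := by
  intro he
  obtain ⟨g, -, -, -, hg⟩ := pet_lift q hq hd hs τ (a τ) hτ (ha.2.2 τ hτ)
  have h1 := hg a (fun t ht => (ha.2.1 t ht).continuousAt.continuousWithinAt) ha.2.2 rfl τ₀ hτ₀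
  have h2 := hg b (fun t ht => (hb.2.1 t ht).continuousAt.continuousWithinAt) hb.2.2 he.symm τ₀ hτ₀
  exact hab (h1.symm.trans h2)

theorem pet_roots (q : Polynomial (Polynomial ℂ)) (hq : q.Monic) (hd : 3 ≤ q.natDegree) (R : ℝ)
    (hs : ∀ z : ℂ, R < ‖z‖ → ∀ w, evZW q z w = 0 → evZW q.derivative z w ≠ 0) :
    ∃ (Y : ℝ) (h : ℕ) (a b c : ℂ → ℂ), 0 < h ∧ 0 ≤ Y ∧ (∀ τ : ℂ, Y < τ.im → R < ‖petE τ‖) ∧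
      PetBranch q Y h a ∧ PetBranch q Y h b ∧ PetBranch q Y h c ∧
      ∀ τ : ℂ, Y < τ.im → a τ ≠ b τ ∧ a τ ≠ c τ ∧ b τ ≠ c τ := by
  have hY : ∀ τ : ℂ, max 0 R < τ.im → R < ‖petE τ‖ := by
    intro τ hτ
    rw [pet_E_norm]
    have h1 : R < τ.im := lt_of_le_of_lt (le_max_right _ _) hτ
    have h0 : 0 < τ.im := lt_of_le_of_lt (le_max_left _ _) hτ
    have h2 := Real.add_one_le_exp (2 * Real.pi * τ.im)
    have h3 := Real.pi_gt_three
    nlinarith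
  set Y := max 0 R
  have hs' : ∀ τ : ℂ, Y < τ.im → ∀ w, evZW q (petE τ) w = 0 → evZW q.derivative (petE τ) w ≠ 0 :=
    fun τ hτ => hs _ (hY τ hτ)
  set τ₀ : ℂ := ((Y + 1 : ℝ) : ℂ) * Complex.I
  have hτ₀ : Y < τ₀.im := by simp [τ₀]
  have hnd : (q.map (Polynomial.evalRingHom (petE τ₀))).natDegree = q.natDegree := hq.natDegree_map _
  obtain ⟨a₀, b₀, c₀, ha₀, hb₀, hc₀, hab, hac, hbc⟩ :=
    pet_three (q.map (Polynomial.evalRingHom (petE τ₀))) (by omega) (fun w hw => by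
      have := hs' τ₀ hτ₀ w hw
      rw [evZW, ← Polynomial.derivative_map] at this
      exact this)
  have hd' : 1 ≤ q.natDegree := by omega
  obtain ⟨a, ka, hka, hA, rfl⟩ := pet_branch q hq hd' hs' τ₀ a₀ hτ₀ ha₀
  obtain ⟨b, kb, hkb, hB, rfl⟩ := pet_branch q hq hd' hs' τ₀ b₀ hτ₀ hb₀
  obtain ⟨c, kc, hkc, hC, rfl⟩ := pet_branch q hq hd' hs' τ₀ c₀ hτ₀ hc₀
  refine ⟨Y, ka * kb * kc, a, b, c, by positivity, le_max_left _ _, hY, ⟨?_, hA.2⟩, ⟨?_, hB.2⟩, ⟨?_, hC.2⟩, ?_⟩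
  · have e : (((ka * kb * kc : ℕ) : ℝ) : ℂ) = ((kb * kc : ℕ) : ℂ) * ((ka : ℝ) : ℂ) := by
      push_cast; ring
    rw [e]
    exact hA.1.nat_mul (kb * kc)
  · have e : (((ka * kb * kc : ℕ) : ℝ) : ℂ) = ((ka * kc : ℕ) : ℂ) * ((kb : ℝ) : ℂ) := by
      push_cast; ring
    rw [e]
    exact hB.1.nat_mul (ka * kc)
  · have e : (((ka * kb * kc : ℕ) : ℝ) : ℂ) = ((ka * kb : ℕ) : ℂ) * ((kc : ℝ) : ℂ) := by
      push_cast; ring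
    rw [e]
    exact hC.1.nat_mul (ka * kb)
  · intro τ hτ
    exact ⟨pet_distinct q hq hd' hs' hA hB hτ₀ hab τ hτ, pet_distinct q hq hd' hs' hA hC hτ₀ hac τ hτ,
      pet_distinct q hq hd' hs' hB hC hτ₀ hbc τ hτ⟩

/-- `W` has a pole at `z`. -/
def PetPole (W : ℂ → ℂ) (z : ℂ) : Prop :=
  Filter.Tendsto W (nhdsWithin z {z}ᶜ) (Bornology.cobounded ℂ)

theorem pet_not_pole {W : ℂ → ℂ} {z : ℂ} (h : AnalyticAt ℂ W z) : ¬ PetPole W z := by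
  intro hp
  have h1 : Filter.Tendsto W (nhdsWithin z {z}ᶜ) (nhds (W z)) :=
    h.continuousAt.tendsto.mono_left nhdsWithin_le_nhds
  have h2 := Metric.disjoint_nhds_cobounded (W z)
  exact h1.not_tendsto h2 hp

open Classical in
/-- The cross-ratio function. -/
noncomputable def petF (W a b c : ℂ → ℂ) (Y : ℝ) (τ : ℂ) : ℂ :=
  if Y < τ.im then
    if PetPole W (petE τ) then (c τ - b τ) / (c τ - a τ) else
      ((W (petE τ) - a τ) * (c τ - b τ)) / ((W (petE τ) - b τ) * (c τ - a τ))
  else 2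

theorem pet_F_per {W a b c : ℂ → ℂ} {Y : ℝ} {h : ℕ}
    (ha : Function.Periodic a ((h : ℝ) : ℂ)) (hb : Function.Periodic b ((h : ℝ) : ℂ))
    (hc : Function.Periodic c ((h : ℝ) : ℂ)) :
    Function.Periodic (petF W a b c Y) ((h : ℝ) : ℂ) := by
  intro τ
  have h1 := pet_E_per τ h
  have h2 : (τ + ((h:ℝ):ℂ)).im = τ.im := by simp
  unfold petF
  rw [ha τ, hb τ, hc τ, h2, Complex.ofReal_natCast, h1]

theorem pet_E_diff (τ : ℂ) : DifferentiableAt ℂ petE τ := by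
  unfold petE; fun_prop

theorem pet_F_diff {W a b c : ℂ → ℂ} {Y : ℝ} 
    (ha : ∀ τ, Y < τ.im → DifferentiableAt ℂ a τ) (hb : ∀ τ, Y < τ.im → DifferentiableAt ℂ b τ)
    (hc : ∀ τ, Y < τ.im → DifferentiableAt ℂ c τ)
    (hac : ∀ τ, Y < τ.im → a τ ≠ c τ)
    (hW : ∀ τ, Y < τ.im → (AnalyticAt ℂ W (petE τ) ∧ W (petE τ) ≠ b τ) ∨
      (MeromorphicAt W (petE τ) ∧ PetPole W (petE τ))) (τ : ℂ) (hτ : Y < τ.im) :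
    DifferentiableAt ℂ (petF W a b c Y) τ := by
  have hopen : IsOpen {τ : ℂ | Y < τ.im} := isOpen_lt continuous_const Complex.continuous_im
  have hnh : {τ : ℂ | Y < τ.im} ∈ nhds τ := hopen.mem_nhds hτ
  have hE := pet_E_diff τ
  have da := ha τ hτ
  have db := hb τ hτ
  have dc := hc τ hτ
  have hca : c τ - a τ ≠ 0 := sub_ne_zero.mpr (hac τ hτ).symm
  rcases hW τ hτ with ⟨hA, hne⟩ | ⟨hM, hP⟩
  · have h1 : ∀ᶠ t in nhds τ, AnalyticAt ℂ W (petE t) :=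
      hE.continuousAt.eventually hA.eventually_analyticAt
    have dW : DifferentiableAt ℂ (fun t => W (petE t)) τ :=
      hA.differentiableAt.comp τ hE
    have : DifferentiableAt ℂ (fun t => ((W (petE t) - a t) * (c t - b t)) /
        ((W (petE t) - b t) * (c t - a t))) τ := by
      refine DifferentiableAt.div (by fun_prop) (by fun_prop) ?_
      exact mul_ne_zero (sub_ne_zero.mpr hne) hca
    refine this.congr_of_eventuallyEq ?_
    filter_upwards [h1, hnh] with t ht ht2
    have ht3 : Y < t.im := ht2
    simp [petF, ht3, pet_not_pole ht]
  · set z := petE τ with hz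
    set V : ℂ → ℂ := Function.update W⁻¹ z 0 with hV
    have hVz : V z = 0 := by simp [hV]
    have hVe : V =ᶠ[nhdsWithin z {z}ᶜ] W⁻¹ := by
      filter_upwards [self_mem_nhdsWithin] with t ht
      have : t ≠ z := ht
      simp [hV, this]
    have hVA : AnalyticAt ℂ V z := by
      apply MeromorphicAt.analyticAt
      · exact hM.inv.congr hVe.symm
      · rw [continuousAt_iff_punctured_nhds, hVz]
        refine Filter.Tendsto.congr' hVe.symm ?_
        exact Filter.tendsto_inv₀_cobounded.comp hP
    have h1 : ∀ᶠ t in nhds z, t ≠ z → AnalyticAt ℂ W t ∧ W t ≠ 0 := by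
      have h2 : ∀ᶠ t in nhdsWithin z {z}ᶜ, W t ≠ 0 := hP.eventually (Bornology.eventually_ne_cobounded 0)
      have h3 := eventually_nhdsWithin_iff.mp (hM.eventually_analyticAt.and h2)
      exact h3
    have h1' := hE.continuousAt.eventually h1
    have dV : DifferentiableAt ℂ (fun t => V (petE t)) τ :=
      DifferentiableAt.comp (g := V) τ hVA.differentiableAt hE
    have : DifferentiableAt ℂ (fun t => ((1 - a t * V (petE t)) * (c t - b t)) /
        ((1 - b t * V (petE t)) * (c t - a t))) τ := by
      refine DifferentiableAt.div (by fun_prop) (by fun_prop) ?_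
      rw [← hz, hVz]
      simpa using hca
    refine this.congr_of_eventuallyEq ?_
    filter_upwards [h1', hnh] with t ht ht2
    have ht3 : Y < t.im := ht2
    by_cases htz : petE t = z
    · simp [petF, ht3, htz, hP, hVz]
    · obtain ⟨ht4, ht5⟩ := ht htz
      have hv : V (petE t) = (W (petE t))⁻¹ := by simp [hV, htz]
      simp only [petF, ht3, if_true, pet_not_pole ht4, if_false, hv]
      have e1 : (W (petE t) - a t) = W (petE t) * (1 - a t * (W (petE t))⁻¹) := by field_simp
      have e2 : (W (petE t) - b t) = W (petE t) * (1 - b t * (W (petE t))⁻¹) := by field_simp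
      rw [e1, e2, mul_assoc, mul_assoc, mul_div_mul_left _ _ ht5]

theorem pet_E_surj (z : ℂ) (hz : z ≠ 0) : ∃ τ, petE τ = z := by
  refine ⟨Complex.log z / (-(2 * Real.pi * Complex.I)), ?_⟩
  unfold petE
  rw [show -(2 * (Real.pi:ℂ) * Complex.I * (Complex.log z / (-(2 * Real.pi * Complex.I)))) = Complex.log z by
    have : (Real.pi : ℂ) ≠ 0 := by exact_mod_cast Real.pi_ne_zero
    field_simp [Complex.I_ne_zero], Complex.exp_log hz]

open Function.Periodic in
theorem pet_concl {q : Polynomial (Polynomial ℂ)} (hq : q.Monic) (hd : 1 ≤ q.natDegree)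
    {W a b c : ℂ → ℂ} {Y Y' M : ℝ} {h : ℕ} (hh : 0 < h) (hY0 : 0 ≤ Y) (hYY : Y ≤ Y')
    (ha : PetBranch q Y h a) (hb : PetBranch q Y h b) (hc : PetBranch q Y h c)
    (hab : ∀ τ, Y < τ.im → a τ ≠ b τ)
    (hac : ∀ τ, Y < τ.im → a τ ≠ c τ)
    (hbc : ∀ τ, Y < τ.im → b τ ≠ c τ)
    (hW : ∀ τ, Y < τ.im → (AnalyticAt ℂ W (petE τ) ∧ W (petE τ) ≠ b τ) ∨
      (MeromorphicAt W (petE τ) ∧ PetPole W (petE τ)))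
    (hM : ∀ τ : ℂ, Y' < τ.im → ‖petF W a b c Y τ‖ ≤ M) :
    ∃ (R C : ℝ) (N : ℕ), ∀ z : ℂ, R < ‖z‖ → AnalyticAt ℂ W z ∧ ‖W z‖ ≤ C * ‖z‖ ^ N := by
  have hh' : (0:ℝ) < h := by exact_mod_cast hh
  obtain ⟨C, N, hCN⟩ := pet_growth q hq hd
  have hgr : ∀ {g : ℂ → ℂ}, PetBranch q Y h g → ∀ τ : ℂ, Y < τ.im →
      ‖g τ‖ ≤ C * Real.exp (2 * Real.pi * N * τ.im) := by
    intro g hg τ hτ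
    have h1 : 1 ≤ ‖petE τ‖ := by
      rw [pet_E_norm]
      apply Real.one_le_exp
      have : 0 ≤ τ.im := (hY0.trans_lt hτ).le
      positivity
    have := hCN _ _ h1 (hg.2.2 τ hτ)
    rw [pet_E_norm, ← Real.exp_nat_mul] at this
    convert this using 3
    ring
  obtain ⟨A, hA, hAe⟩ := pet_cusp hh ha.1 ha.2.1 (hgr ha)
  obtain ⟨B, hB, hBe⟩ := pet_cusp hh hb.1 hb.2.1 (hgr hb)
  obtain ⟨K, hK, hKe⟩ := pet_cusp hh hc.1 hc.2.1 (hgr hc)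
  obtain ⟨F, hF, hFe⟩ := pet_cusp (N := 0) (C := M) (Y := Y') hh (pet_F_per (W := W) (Y := Y) ha.1 hb.1 hc.1)
    (fun τ hτ => pet_F_diff ha.2.1 hb.2.1 hc.2.1 hac hW τ (hYY.trans_lt hτ))
    (fun τ hτ => by simpa using hM τ hτ)
  set D : ℂ → ℂ := (K - B) - F * (K - A) with hD
  set U : ℂ → ℂ := A * (K - B) - F * B * (K - A) with hU
  have hDm : MeromorphicAt D 0 := (hK.sub hB).sub (hF.mul (hK.sub hA))
  have hUm : MeromorphicAt U 0 := (hA.mul (hK.sub hB)).sub ((hF.mul hB).mul (hK.sub hA))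
  have hDe : ∀ τ : ℂ, D (qParam h τ) = (c τ - b τ) - petF W a b c Y τ * (c τ - a τ) := by
    intro τ; simp [hD, hAe, hBe, hKe, hFe]
  have hUe : ∀ τ : ℂ, U (qParam h τ) = a τ * (c τ - b τ) - petF W a b c Y τ * b τ * (c τ - a τ) := by
    intro τ; simp [hU, hAe, hBe, hKe, hFe]
  have key1 : ∀ τ : ℂ, Y < τ.im → PetPole W (petE τ) → D (qParam h τ) = 0 := by
    intro τ hτ hp
    have : c τ - a τ ≠ 0 := sub_ne_zero.mpr (hac τ hτ).symm
    rw [hDe]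
    simp only [petF, hτ, hp, if_true]
    field_simp
    ring
  have key2 : ∀ τ : ℂ, Y < τ.im → ¬ PetPole W (petE τ) → AnalyticAt ℂ W (petE τ) ∧
      D (qParam h τ) ≠ 0 ∧ W (petE τ) * D (qParam h τ) = U (qParam h τ) := by
    intro τ hτ hp
    obtain ⟨hWa, hne⟩ := (hW τ hτ).resolve_right (fun h => hp h.2)
    have h1 : c τ - a τ ≠ 0 := sub_ne_zero.mpr (hac τ hτ).symm
    have h2 : W (petE τ) - b τ ≠ 0 := sub_ne_zero.mpr hne
    have h3 : W (petE τ) * D (qParam h τ) = U (qParam h τ) := by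
      rw [hDe, hUe]
      simp only [petF, hτ, hp, if_true, if_false]
      field_simp
      ring
    refine ⟨hWa, fun h0 => ?_, h3⟩
    rw [h0, mul_zero] at h3
    rw [hDe] at h0
    rw [hUe] at h3
    have h4 : (a τ - b τ) * (c τ - b τ) = 0 := by linear_combination -h3 - b τ * h0
    rcases mul_eq_zero.mp h4 with h5 | h5
    · exact hab τ hτ (sub_eq_zero.mp h5)
    · exact hbc τ hτ (sub_eq_zero.mp h5).symm
  have hev : ∀ {p : ℂ → Prop}, (∀ᶠ x in nhdsWithin (0:ℂ) {0}ᶜ, p x) →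
      ∃ Y2 : ℝ, Y ≤ Y2 ∧ ∀ τ : ℂ, Y2 < τ.im → p (qParam h τ) := by
    intro p hp
    have h1 := (qParam_tendsto hh').eventually hp
    rw [Filter.eventually_comap, Filter.eventually_atTop] at h1
    obtain ⟨Y2, hY2⟩ := h1
    exact ⟨max Y Y2, le_max_left _ _, fun τ hτ =>
      hY2 τ.im ((le_max_right _ _).trans hτ.le) τ rfl⟩
  have hDne : ∀ᶠ x in nhdsWithin (0:ℂ) {0}ᶜ, D x ≠ 0 := by
    rcases hDm.eventually_eq_zero_or_eventually_ne_zero with h0 | h0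
    · exfalso
      obtain ⟨Y2, hYY2, hY2⟩ := hev h0
      have hpole : ∀ τ : ℂ, Y2 < τ.im → PetPole W (petE τ) := by
        intro τ hτ
        by_contra hp
        exact (key2 τ (hYY2.trans_lt hτ) hp).2.1 (hY2 τ hτ)
      set τ₀ : ℂ := ((Y2 + 1 : ℝ) : ℂ) * Complex.I
      have hτ₀ : Y2 < τ₀.im := by simp [τ₀]
      have hm : MeromorphicAt W (petE τ₀) := by
        rcases hW τ₀ (hYY2.trans_lt hτ₀) with h | h
        · exact h.1.meromorphicAt
        · exact h.1
      have hn : ∀ᶠ z in nhdsWithin (petE τ₀) {petE τ₀}ᶜ, Real.exp (2 * Real.pi * Y2) < ‖z‖ := by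
        apply nhdsWithin_le_nhds
        apply (isOpen_lt continuous_const continuous_norm).mem_nhds
        show Real.exp (2 * Real.pi * Y2) < ‖petE τ₀‖
        rw [pet_E_norm]
        have := Real.pi_pos
        gcongr
      obtain ⟨z, hz1, hz2⟩ := (hm.eventually_analyticAt.and hn).exists
      obtain ⟨τ, rfl⟩ := pet_E_surj z (by
        intro h; rw [h, norm_zero] at hz2; exact absurd hz2 (not_lt.mpr (Real.exp_pos _).le))
      refine pet_not_pole hz1 (hpole τ ?_)
      rw [pet_E_norm, Real.exp_lt_exp] at hz2
      have := Real.pi_pos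
      nlinarith
    · exact h0
  have hGm : MeromorphicAt (U / D) 0 := hUm.div hDm
  obtain ⟨n, hn⟩ := hGm
  have hnb : ∀ᶠ x in nhdsWithin (0:ℂ) {0}ᶜ, ‖(x - 0) ^ n • (U / D) x‖ < ‖((0:ℂ) - 0) ^ n • (U / D) 0‖ + 1 := by
    apply nhdsWithin_le_nhds
    exact hn.continuousAt.norm.eventually (gt_mem_nhds (lt_add_one _))
  set C2 := ‖((0:ℂ) - 0) ^ n • (U / D) 0‖ + 1
  have hC2 : 0 ≤ C2 := by positivity
  obtain ⟨Y2, hYY2, hY2⟩ := hev (hDne.and hnb)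
  refine ⟨Real.exp (2 * Real.pi * Y2), C2, n, fun z hz => ?_⟩
  obtain ⟨τ, rfl⟩ := pet_E_surj z (by
        intro h; rw [h, norm_zero] at hz; exact absurd hz (not_lt.mpr (Real.exp_pos _).le))
  have hpi := Real.pi_pos
  have hτ2 : Y2 < τ.im := by
    rw [pet_E_norm, Real.exp_lt_exp] at hz
    nlinarith
  have hτ : Y < τ.im := hYY2.trans_lt hτ2
  obtain ⟨h1, h2⟩ := hY2 τ hτ2
  obtain ⟨k1, -, k3⟩ := key2 τ hτ (fun hp => h1 (key1 τ hτ hp))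
  refine ⟨k1, ?_⟩
  have h3 : (U / D) (qParam h τ) = W (petE τ) := by
    rw [Pi.div_apply, ← k3]; field_simp
  rw [h3, sub_zero, norm_smul, norm_pow, norm_qParam] at h2
  rw [pet_E_norm]
  have him : 0 ≤ τ.im := (hY0.trans_lt hτ).le
  have h4 : 1 ≤ Real.exp (-2 * Real.pi * τ.im / h) * Real.exp (2 * Real.pi * τ.im) := by
    rw [← Real.exp_add]
    apply Real.one_le_exp
    have h5 : (1:ℝ) ≤ h := by exact_mod_cast hh
    have h6 : 2 * Real.pi * τ.im / h ≤ 2 * Real.pi * τ.im := div_le_self (by positivity) h5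
    have h7 : -2 * Real.pi * τ.im / h = - (2 * Real.pi * τ.im / h) := by ring
    linarith
  have h5 : 1 ≤ Real.exp (-2 * Real.pi * τ.im / h) ^ n * Real.exp (2 * Real.pi * τ.im) ^ n := by
    rw [← mul_pow]; exact one_le_pow₀ h4
  set x := Real.exp (-2 * Real.pi * τ.im / h) ^ n
  set y := Real.exp (2 * Real.pi * τ.im) ^ n
  have hy : 0 ≤ y := by positivity
  calc ‖W (petE τ)‖ ≤ ‖W (petE τ)‖ * (x * y) := le_mul_of_one_le_right (norm_nonneg _) h5
    _ = (x * ‖W (petE τ)‖) * y := by ring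
    _ ≤ C2 * y := by gcongr

theorem pet_thmA (q : Polynomial (Polynomial ℂ)) (hq : q.Monic) (hd : 3 ≤ q.natDegree) (R : ℝ)
    (hs : ∀ z : ℂ, R < ‖z‖ → ∀ w, evZW q z w = 0 → evZW q.derivative z w ≠ 0)
    (W : ℂ → ℂ) (hW : ∀ z : ℂ, R < ‖z‖ → (AnalyticAt ℂ W z ∧ evZW q z (W z) ≠ 0) ∨
      (MeromorphicAt W z ∧ PetPole W z)) :
    ∃ (R C : ℝ) (N : ℕ), ∀ z : ℂ, R < ‖z‖ → AnalyticAt ℂ W z ∧ ‖W z‖ ≤ C * ‖z‖ ^ N := by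
  obtain ⟨Y, h, a, b, c, hh, hY0, hYR, ha, hb, hc, hdis⟩ := pet_roots q hq hd R hs
  have hh' : (0:ℝ) < h := by exact_mod_cast hh
  have hd' : 1 ≤ q.natDegree := by omega
  have hWg : ∀ {g : ℂ → ℂ}, PetBranch q Y h g → ∀ τ : ℂ, Y < τ.im →
      (AnalyticAt ℂ W (petE τ) ∧ W (petE τ) ≠ g τ) ∨ (MeromorphicAt W (petE τ) ∧ PetPole W (petE τ)) := by
    intro g hg τ hτ
    refine (hW (petE τ) (hYR τ hτ)).imp (fun h => ⟨h.1, fun he => h.2 ?_⟩) id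
    rw [he]; exact hg.2.2 τ hτ
  have hab : ∀ τ : ℂ, Y < τ.im → a τ ≠ b τ := fun τ hτ => (hdis τ hτ).1
  have hac : ∀ τ : ℂ, Y < τ.im → a τ ≠ c τ := fun τ hτ => (hdis τ hτ).2.1
  have hbc : ∀ τ : ℂ, Y < τ.im → b τ ≠ c τ := fun τ hτ => (hdis τ hτ).2.2
  have f0 : ∀ τ : ℂ, Y < τ.im → petF W a b c Y τ ≠ 0 := by
    intro τ hτ
    have n1 := sub_ne_zero.mpr (hac τ hτ).symm
    have n2 := sub_ne_zero.mpr (hbc τ hτ).symm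
    by_cases hp : PetPole W (petE τ)
    · simp only [petF, hτ, hp, if_true]
      exact div_ne_zero n2 n1
    · simp only [petF, hτ, hp, if_true, if_false]
      have n3 := sub_ne_zero.mpr ((hWg ha τ hτ).resolve_right (fun h => hp h.2)).2
      have n4 := sub_ne_zero.mpr ((hWg hb τ hτ).resolve_right (fun h => hp h.2)).2
      exact div_ne_zero (mul_ne_zero n3 n2) (mul_ne_zero n4 n1)
  have f1 : ∀ τ : ℂ, Y < τ.im → petF W a b c Y τ ≠ 1 := by
    intro τ hτ
    have n1 := sub_ne_zero.mpr (hac τ hτ).symm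
    have n2 := sub_ne_zero.mpr (hab τ hτ)
    by_cases hp : PetPole W (petE τ)
    · simp only [petF, hτ, hp, if_true]
      rw [Ne, div_eq_one_iff_eq n1]
      intro he
      apply n2; linear_combination he
    · simp only [petF, hτ, hp, if_true, if_false]
      have n3 := sub_ne_zero.mpr ((hWg hc τ hτ).resolve_right (fun h => hp h.2)).2
      have n4 := sub_ne_zero.mpr ((hWg hb τ hτ).resolve_right (fun h => hp h.2)).2
      rw [Ne, div_eq_one_iff_eq (mul_ne_zero n4 n1)]
      intro he
      apply mul_ne_zero n3 n2; linear_combination he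
  obtain ⟨Y', hYY, M, hM⟩ := pet_dichotomy hh'
    (pet_F_diff ha.2.1 hb.2.1 hc.2.1 hac (hWg hb)) f0 f1 (pet_F_per ha.1 hb.1 hc.1)
  rcases hM with hM | hM
  · exact pet_concl hq hd' hh hY0 hYY ha hb hc hab hac hbc (hWg hb) hM
  · refine pet_concl (M := 1) hq hd' hh hY0 hYY hb ha hc (fun τ hτ => (hab τ hτ).symm) hbc hac (hWg ha) ?_
    intro τ hτ
    have hτ' : Y < τ.im := hYY.trans_lt hτ
    have : petF W b a c Y τ = (petF W a b c Y τ)⁻¹ := by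
      unfold petF
      simp only [hτ', if_true]
      split_ifs <;> rw [inv_div]
    rw [this, norm_inv]
    exact inv_le_one_of_one_le₀ (hM τ hτ)

theorem pet_entire {g : ℂ → ℂ} (hg : Differentiable ℂ g) {R C : ℝ} {N : ℕ}
    (hb : ∀ z : ℂ, R < ‖z‖ → ‖g z‖ ≤ C * ‖z‖ ^ N) : ∃ A : Polynomial ℂ, ∀ z, g z = A.eval z := by
  have h0 : ∀ n, N < n → iteratedDeriv n g 0 = 0 := by
    intro n hn
    have h1 : ∀ r : ℝ, max R 1 < r → ‖iteratedDeriv n g 0‖ ≤ n.factorial * |C| / r := by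
      intro r hr
      have hrR : R < r := lt_of_le_of_lt (le_max_left _ _) hr
      have hr1 : 1 < r := lt_of_le_of_lt (le_max_right _ _) hr
      have hr0 : 0 < r := by linarith
      have h2 := Complex.norm_iteratedDeriv_le_of_forall_mem_sphere_norm_le (c := 0) (C := |C| * r ^ N) n hr0
        hg.diffContOnCl (fun z hz => by
          have hz' : ‖z‖ = r := by simpa using hz
          have := hb z (by rw [hz']; exact hrR)
          rw [hz'] at this
          refine this.trans ?_
          gcongr
          exact le_abs_self C)
      refine h2.trans ?_
      rw [div_le_div_iff₀ (by positivity) hr0]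
      have : r ^ N * r ≤ r ^ n := by
        rw [← pow_succ]; exact pow_le_pow_right₀ hr1.le hn
      calc (n.factorial : ℝ) * (|C| * r ^ N) * r = n.factorial * |C| * (r ^ N * r) := by ring
        _ ≤ n.factorial * |C| * r ^ n := by gcongr
    have h3 : Filter.Tendsto (fun r : ℝ => n.factorial * |C| / r) Filter.atTop (nhds 0) :=
      Filter.Tendsto.const_div_atTop Filter.tendsto_id _
    have h4 : ‖iteratedDeriv n g 0‖ ≤ 0 := by
      apply ge_of_tendsto h3
      filter_upwards [Filter.eventually_gt_atTop (max R 1)] with r hr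
      exact h1 r hr
    simpa using h4
  refine ⟨∑ n ∈ Finset.range (N + 1), Polynomial.C ((n.factorial : ℂ)⁻¹ * iteratedDeriv n g 0) * Polynomial.X ^ n,
    fun z => ?_⟩
  rw [← Complex.taylorSeries_eq_of_entire' 0 z hg, tsum_eq_sum (s := Finset.range (N + 1))]
  · simp [Polynomial.eval_finset_sum]
  · intro n hn
    rw [h0 n (by simpa using hn)]; simp

theorem pet_rational {W : ℂ → ℂ} (hW : MeromorphicOn W Set.univ) {R C : ℝ} {N : ℕ}
    (hb : ∀ z : ℂ, R < ‖z‖ → AnalyticAt ℂ W z ∧ ‖W z‖ ≤ C * ‖z‖ ^ N) :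
    ∃ A B : Polynomial ℂ, B ≠ 0 ∧ ∀ z, W z * B.eval z = A.eval z := by
  classical
  have hfin : {z : ℂ | ¬ AnalyticAt ℂ W z}.Finite := by
    have hsub : {z : ℂ | ¬ AnalyticAt ℂ W z} ⊆ Metric.closedBall 0 R := by
      intro z hz
      by_contra h
      exact hz (hb z (by simpa using h)).1
    have h1 : ∀ p : ℂ, ∃ U ∈ nhds p, (U ∩ {z : ℂ | ¬ AnalyticAt ℂ W z}) ⊆ {p} := by
      intro p
      have := eventually_nhdsWithin_iff.mp ((hW p (Set.mem_univ _)).eventually_analyticAt)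
      refine ⟨_, this, ?_⟩
      rintro z ⟨hz1, hz2⟩
      by_contra h
      exact hz2 (hz1 h)
    choose U hU hUs using h1
    obtain ⟨t, -, ht⟩ := (isCompact_closedBall (0:ℂ) R).elim_nhds_subcover U (fun x _ => hU x)
    refine t.finite_toSet.subset ?_
    intro z hz
    have := ht (hsub hz)
    simp only [Set.mem_iUnion] at this
    obtain ⟨p, hp, hzp⟩ := this
    have : z = p := hUs p ⟨hzp, hz⟩
    rw [this]; exact hp
  have hn : ∀ p : ℂ, ∃ n : ℕ, AnalyticAt ℂ (fun z => (z - p) ^ n • W z) p := fun p => hW p (Set.mem_univ _)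
  choose n hn using hn
  set B : Polynomial ℂ := ∏ p ∈ hfin.toFinset, (Polynomial.X - Polynomial.C p) ^ n p with hB
  have hB0 : B ≠ 0 := by
    rw [hB, Finset.prod_ne_zero_iff]
    intro p _
    exact pow_ne_zero _ (Polynomial.X_sub_C_ne_zero p)
  have hBa : ∀ (p : Polynomial ℂ) (z : ℂ), AnalyticAt ℂ (fun z => p.eval z) z := by
    intro p z
    exact p.differentiable.analyticAt z
  have hg : ∀ z, AnalyticAt ℂ (fun z => W z * B.eval z) z := by
    intro z
    by_cases hz : AnalyticAt ℂ W z
    · exact hz.mul (hBa B z)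
    · have hmem : z ∈ hfin.toFinset := by simpa using hz
      have hBe : B = (Polynomial.X - Polynomial.C z) ^ n z *
          ∏ p ∈ hfin.toFinset.erase z, (Polynomial.X - Polynomial.C p) ^ n p :=
        (Finset.mul_prod_erase _ _ hmem).symm
      set B2 := ∏ p ∈ hfin.toFinset.erase z, (Polynomial.X - Polynomial.C p) ^ n p
      have := (hn z).mul (hBa B2 z)
      have e : (fun t => W t * B.eval t) = (fun t => (t - z) ^ n z • W t) * fun t => B2.eval t := by
        ext t
        rw [hBe]
        simp
        ring
      rw [e]
      exact this
  have hgd : Differentiable ℂ (fun z => W z * B.eval z) := fun z => (hg z).differentiableAt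
  obtain ⟨C', hC', N', hBb⟩ := pet_poly_growth B
  obtain ⟨A, hA⟩ := pet_entire hgd (R := max R 1) (C := C * C') (N := N + N') (fun z hz => by
    have hrR : R < ‖z‖ := lt_of_le_of_lt (le_max_left _ _) hz
    have hr1 : 1 < ‖z‖ := lt_of_le_of_lt (le_max_right _ _) hz
    have h1 := (hb z hrR).2
    have h2 := hBb z hr1.le
    rw [norm_mul]
    calc ‖W z‖ * ‖B.eval z‖ ≤ (C * ‖z‖ ^ N) * (C' * ‖z‖ ^ N') := by
          apply mul_le_mul h1 h2 (norm_nonneg _) ((norm_nonneg _).trans h1)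
      _ = _ := by ring)
  exact ⟨A, B, hB0, hA⟩

theorem pet_clear (p q : Polynomial (Polynomial ℂ))
    (hc : IsCoprime (p.map (algebraMap (Polynomial ℂ) (RatFunc ℂ)))
                      (q.map (algebraMap (Polynomial ℂ) (RatFunc ℂ)))) :
    ∃ (d : Polynomial ℂ) (a b : Polynomial (Polynomial ℂ)), d ≠ 0 ∧ a * p + b * q = Polynomial.C d := by
  obtain ⟨u, v, huv⟩ := hc
  obtain ⟨d1, hd1, h1⟩ := IsLocalization.integerNormalization_spec (nonZeroDivisors (Polynomial ℂ)) u
  obtain ⟨d2, hd2, h2⟩ := IsLocalization.integerNormalization_spec (nonZeroDivisors (Polynomial ℂ)) v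
  set U := IsLocalization.integerNormalization (nonZeroDivisors (Polynomial ℂ)) u
  set V := IsLocalization.integerNormalization (nonZeroDivisors (Polynomial ℂ)) v
  refine ⟨d1 * d2, Polynomial.C d2 * U, Polynomial.C d1 * V,
    mul_ne_zero (nonZeroDivisors.ne_zero hd1) (nonZeroDivisors.ne_zero hd2), ?_⟩
  apply Polynomial.map_injective _ (IsFractionRing.injective (Polynomial ℂ) (RatFunc ℂ))
  simp only [Polynomial.map_add, Polynomial.map_mul, Polynomial.map_C, h1, h2]
  have e : ∀ (d : Polynomial ℂ) (x : Polynomial (RatFunc ℂ)),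
      d • x = Polynomial.C (algebraMap (Polynomial ℂ) (RatFunc ℂ) d) * x := by
    intro d x
    rw [← Polynomial.smul_eq_C_mul, algebraMap_smul]
  rw [e, e, map_mul, Polynomial.C_mul]
  linear_combination (Polynomial.C (algebraMap (Polynomial ℂ) (RatFunc ℂ) d1) *
    Polynomial.C (algebraMap (Polynomial ℂ) (RatFunc ℂ) d2)) * huv

theorem pet_large (d : Polynomial ℂ) (hd : d ≠ 0) : ∃ R : ℝ, ∀ z : ℂ, R < ‖z‖ → d.eval z ≠ 0 := by
  classical
  obtain ⟨R, hR⟩ := (d.roots.toFinset.finite_toSet.isBounded).exists_norm_le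
  refine ⟨R, fun z hz h => ?_⟩
  have := hR z (by simpa [hd] using h)
  linarith

theorem pet_ev_mul (a p : Polynomial (Polynomial ℂ)) (z w : ℂ) :
    evZW (a * p) z w = evZW a z w * evZW p z w := by
  simp [evZW]

theorem pet_coprime (p q : Polynomial (Polynomial ℂ))
    (hc : IsCoprime (p.map (algebraMap (Polynomial ℂ) (RatFunc ℂ)))
                      (q.map (algebraMap (Polynomial ℂ) (RatFunc ℂ)))) :
    ∃ R : ℝ, ∀ z : ℂ, R < ‖z‖ → ∀ w, evZW p z w = 0 → evZW q z w ≠ 0 := by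
  obtain ⟨d, a, b, hd, hab⟩ := pet_clear p q hc
  obtain ⟨R, hR⟩ := pet_large d hd
  refine ⟨R, fun z hz w hp hq => hR z hz ?_⟩
  have h1 := congrArg (fun x => evZW x z w) hab
  simp only [evZW, Polynomial.map_add, Polynomial.map_mul, Polynomial.eval_add, Polynomial.eval_mul,
    Polynomial.map_C, Polynomial.eval_C] at h1
  unfold evZW at hp hq
  rw [hp, hq] at h1
  simpa using h1.symm

theorem pet_algebra (Q : Polynomial (Polynomial ℂ)) (hQ : Q ≠ 0)
    (α β γ : AlgebraicClosure (RatFunc ℂ))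
    (hαβ : α ≠ β) (hαγ : α ≠ γ) (hβγ : β ≠ γ)
    (hα : Polynomial.aeval α (Q.map (algebraMap (Polynomial ℂ) (RatFunc ℂ))) = 0)
    (hβ : Polynomial.aeval β (Q.map (algebraMap (Polynomial ℂ) (RatFunc ℂ))) = 0)
    (hγ : Polynomial.aeval γ (Q.map (algebraMap (Polynomial ℂ) (RatFunc ℂ))) = 0) :
    ∃ q : Polynomial (Polynomial ℂ), q.Monic ∧ 3 ≤ q.natDegree ∧ q ∣ Q.integralNormalization ∧
      IsCoprime (q.map (algebraMap (Polynomial ℂ) (RatFunc ℂ)))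
        (q.derivative.map (algebraMap (Polynomial ℂ) (RatFunc ℂ))) := by
  classical
  set φ := algebraMap (Polynomial ℂ) (RatFunc ℂ) with hφ
  have hφi : Function.Injective φ := IsFractionRing.injective (Polynomial ℂ) (RatFunc ℂ)
  set ψ := (algebraMap (RatFunc ℂ) (AlgebraicClosure (RatFunc ℂ))).comp φ with hψ
  have hψi : Function.Injective ψ := (algebraMap (RatFunc ℂ) (AlgebraicClosure (RatFunc ℂ))).injective.comp hφi
  have hmon := Polynomial.monic_integralNormalization hQ
  obtain ⟨r, n, hsq, hrd, hdr⟩ := exists_squarefree_dvd_pow_of_ne_zero (hmon.map φ).ne_zero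
  have hr0 : r ≠ 0 := hsq.ne_zero
  have hroot : ∀ x : AlgebraicClosure (RatFunc ℂ), Polynomial.aeval x (Q.map φ) = 0 →
      Polynomial.aeval (ψ Q.leadingCoeff * x) r = 0 := by
    intro x hx
    rw [Polynomial.aeval_def, Polynomial.eval₂_map] at hx
    have h1 := Polynomial.integralNormalization_eval₂_eq_zero ψ hx
      (fun y hy => hψi (by rw [hy, map_zero]))
    obtain ⟨s, hs⟩ := hdr
    have h2 : Polynomial.aeval (ψ Q.leadingCoeff * x) (r ^ n) = 0 := by
      rw [hs, map_mul, Polynomial.aeval_def, Polynomial.eval₂_map, h1, zero_mul]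
    rw [map_pow] at h2
    exact eq_zero_of_pow_eq_zero h2
  have hlc : ψ Q.leadingCoeff ≠ 0 := by
    rw [map_ne_zero_iff _ hψi]; simpa using hQ
  have hdeg : 3 ≤ r.natDegree := by
    set r' := r.map (algebraMap (RatFunc ℂ) (AlgebraicClosure (RatFunc ℂ)))
    have hr' : r' ≠ 0 := (Polynomial.map_ne_zero_iff (algebraMap (RatFunc ℂ) (AlgebraicClosure (RatFunc ℂ))).injective).mpr hr0
    have hmem : ∀ x : AlgebraicClosure (RatFunc ℂ), Polynomial.aeval x (Q.map φ) = 0 →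
        ψ Q.leadingCoeff * x ∈ r'.roots.toFinset := by
      intro x hx
      rw [Multiset.mem_toFinset, Polynomial.mem_roots hr', Polynomial.IsRoot.def, Polynomial.eval_map]
      exact hroot x hx
    have h3 : 2 < r'.roots.toFinset.card := Finset.two_lt_card.mpr
      ⟨_, hmem α hα, _, hmem β hβ, _, hmem γ hγ, (mul_right_injective₀ hlc).ne hαβ,
        (mul_right_injective₀ hlc).ne hαγ, (mul_right_injective₀ hlc).ne hβγ⟩
    have h4 := r'.roots.toFinset_card_le
    have h5 := r'.card_roots'
    have h6 : r'.natDegree = r.natDegree := Polynomial.natDegree_map _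
    omega
  obtain ⟨q, hq⟩ := IsIntegrallyClosed.eq_map_mul_C_of_dvd (RatFunc ℂ) hmon hrd
  have hl0 : r.leadingCoeff ≠ 0 := by simpa using hr0
  have hqm : q.Monic := by
    have h1 := congrArg Polynomial.leadingCoeff hq
    rw [Polynomial.leadingCoeff_mul, Polynomial.leadingCoeff_C] at h1
    have h2 : (q.map φ).Monic := by
      rw [Polynomial.Monic]
      exact mul_right_cancel₀ hl0 (by rw [h1, one_mul])
    exact Polynomial.monic_of_injective hφi h2
  have hqd : (q.map φ) ∣ r := ⟨_, hq.symm⟩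
  refine ⟨q, hqm, ?_, ?_, ?_⟩
  · have h1 := congrArg Polynomial.natDegree hq
    rw [Polynomial.natDegree_mul_C hl0, Polynomial.natDegree_map_eq_of_injective hφi] at h1
    omega
  · rw [← Polynomial.map_dvd_map φ hφi hqm]
    exact hqd.trans hrd
  · have h1 : Squarefree (q.map φ) := hsq.squarefree_of_dvd hqd
    have h2 := PerfectField.separable_iff_squarefree.mpr h1
    rw [Polynomial.separable_def, Polynomial.derivative_map] at h2
    exact h2

theorem pet_ev_cont (P : Polynomial (Polynomial ℂ)) {v : ℂ → ℂ} {z : ℂ} (hv : ContinuousAt v z) :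
    ContinuousAt (fun t => evZW P t (v t)) z := by
  simp only [pet_ev_sum]
  fun_prop

theorem pet_main
    (n : ℕ) (hn : 1 ≤ n)
    (P Q : Polynomial (Polynomial ℂ))
    (hcop : IsCoprime (P.map (algebraMap (Polynomial ℂ) (RatFunc ℂ)))
                      (Q.map (algebraMap (Polynomial ℂ) (RatFunc ℂ))))
    (hdegQ : Q.natDegree = n) (hQ : Q ≠ 0)
    (α β γ : AlgebraicClosure (RatFunc ℂ))
    (hαβ : α ≠ β) (hαγ : α ≠ γ) (hβγ : β ≠ γ)
    (hα : Polynomial.aeval α (Q.map (algebraMap (Polynomial ℂ) (RatFunc ℂ))) = 0)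
    (hβ : Polynomial.aeval β (Q.map (algebraMap (Polynomial ℂ) (RatFunc ℂ))) = 0)
    (hγ : Polynomial.aeval γ (Q.map (algebraMap (Polynomial ℂ) (RatFunc ℂ))) = 0)
    (w : ℂ → ℂ) (hw : MeromorphicOn w Set.univ)
    (hode : ∀ z : ℂ, AnalyticAt ℂ w z →
      deriv w z * evZW Q z (w z) = evZW P z (w z)) :
    ∃ A B : Polynomial ℂ, B ≠ 0 ∧
      ∀ z : ℂ, AnalyticAt ℂ w z → w z * B.eval z = A.eval z := by
  obtain ⟨q, hqm, hq3, hqd, hqs⟩ := pet_algebra Q hQ α β γ hαβ hαγ hβγ hα hβ hγ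
  obtain ⟨R1, hR1⟩ := pet_coprime _ _ hcop
  obtain ⟨R2, hR2⟩ := pet_coprime _ _ hqs
  set l := Q.leadingCoeff with hl
  have hl0 : l ≠ 0 := by simpa [hl] using hQ
  obtain ⟨R3, hR3⟩ := pet_large l hl0
  set v := toMeromorphicNFOn w Set.univ with hv
  have hvw : ∀ z, v =ᶠ[nhdsWithin z {z}ᶜ] w := fun z =>
    hw.toMeromorphicNFOn_eq_self_on_nhdsNE (Set.mem_univ z)
  have hvNF : ∀ z, MeromorphicNFAt v z := fun z => meromorphicNFOn_toMeromorphicNFOn w Set.univ (Set.mem_univ z)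
  have hvm : ∀ z, MeromorphicAt v z := fun z => (hvNF z).meromorphicAt
  have hvode : ∀ z, AnalyticAt ℂ v z → deriv v z * evZW Q z (v z) = evZW P z (v z) := by
    intro z hz
    have hc1 : ContinuousAt (fun t => deriv v t * evZW Q t (v t)) z :=
      hz.deriv.continuousAt.mul (pet_ev_cont Q hz.continuousAt)
    have hc2 : ContinuousAt (fun t => evZW P t (v t)) z := pet_ev_cont P hz.continuousAt
    have he : (fun t => deriv v t * evZW Q t (v t)) =ᶠ[nhdsWithin z {z}ᶜ] (fun t => evZW P t (v t)) := by
      filter_upwards [(hw z (Set.mem_univ _)).eventually_analyticAt,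
        eventually_eventually_nhdsWithin.mpr (hvw z), self_mem_nhdsWithin] with t ht1 ht2 ht3
      have ht4 : v =ᶠ[nhds t] w := by
        have : nhdsWithin t {z}ᶜ = nhds t := isOpen_compl_singleton.nhdsWithin_eq ht3
        rw [this] at ht2
        exact ht2
      rw [ht4.deriv_eq, ht4.eq_of_nhds]
      exact hode t ht1
    exact tendsto_nhds_unique_of_eventuallyEq
      (hc1.tendsto.mono_left nhdsWithin_le_nhds) (hc2.tendsto.mono_left nhdsWithin_le_nhds) he
  have hla : ∀ z, AnalyticAt ℂ (fun t => l.eval t) z := fun z => l.differentiable.analyticAt z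
  set W : ℂ → ℂ := fun z => l.eval z * v z with hWdef
  have hWm : ∀ z, MeromorphicAt W z := fun z => (hla z).meromorphicAt.mul (hvm z)
  obtain ⟨R, C, N, hRCN⟩ := pet_thmA q hqm hq3 (max R1 (max R2 R3))
    (fun z hz => hR2 z (lt_of_le_of_lt ((le_max_left _ _).trans (le_max_right _ _)) hz)) W (by
    intro z hz
    have hz1 : R1 < ‖z‖ := lt_of_le_of_lt (le_max_left _ _) hz
    have hz3 : R3 < ‖z‖ := lt_of_le_of_lt ((le_max_right _ _).trans (le_max_right _ _)) hz
    have hlz := hR3 z hz3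
    by_cases hz : AnalyticAt ℂ v z
    · left
      refine ⟨(hla z).mul hz, fun h0 => ?_⟩
      obtain ⟨s, hs⟩ := hqd
      have h1 : evZW Q.integralNormalization z (W z) = 0 := by
        rw [hs, pet_ev_mul, h0, zero_mul]
      have h2 := Polynomial.integralNormalization_eval₂_leadingCoeff_mul (p := Q) (by omega)
        (Polynomial.evalRingHom z) (v z)
      rw [← Polynomial.eval_map, ← Polynomial.eval_map] at h2
      have h3 : evZW Q z (v z) = 0 := by
        have h4 : (0:ℂ) = l.eval z ^ (Q.natDegree - 1) * evZW Q z (v z) := h1.symm.trans h2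
        exact (mul_eq_zero.mp h4.symm).resolve_left (pow_ne_zero _ hlz)
      have h5 := hvode z hz
      rw [h3, mul_zero] at h5
      exact hR1 z hz1 _ h5.symm h3
    · right
      refine ⟨hWm z, ?_⟩
      have h1 : meromorphicOrderAt v z < 0 := by
        rw [← (hvNF z).meromorphicOrderAt_nonneg_iff_analyticAt] at hz
        exact not_le.mp hz
      have h2 := (tendsto_cobounded_iff_meromorphicOrderAt_neg (hvm z)).mpr h1
      unfold PetPole
      rw [← tendsto_norm_atTop_iff_cobounded] at h2 ⊢
      simp only [hWdef, norm_mul]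
      exact Filter.Tendsto.pos_mul_atTop (norm_pos_iff.mpr hlz)
        ((hla z).continuousAt.norm.tendsto.mono_left nhdsWithin_le_nhds) h2)
  obtain ⟨A, B, hB, hAB⟩ := pet_rational (fun z _ => hWm z) hRCN
  refine ⟨A, l * B, mul_ne_zero hl0 hB, fun z hz => ?_⟩
  have hc1 : ContinuousAt (fun t => w t * (l * B).eval t) z :=
    hz.continuousAt.mul (l * B).continuous.continuousAt
  have hc2 : ContinuousAt (fun t => A.eval t) z := A.continuous.continuousAt
  have he : (fun t => w t * (l * B).eval t) =ᶠ[nhdsWithin z {z}ᶜ] (fun t => A.eval t) := by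
    filter_upwards [hvw z] with t ht
    rw [← hAB t, ← ht, Polynomial.eval_mul]
    simp only [hWdef]
    ring
  exact tendsto_nhds_unique_of_eventuallyEq
      (hc1.tendsto.mono_left nhdsWithin_le_nhds) (hc2.tendsto.mono_left nhdsWithin_le_nhds) he

/-- **Petrović's theorem (1894)** for generalized Riccati equations
`w' = P_{n+2}(w, z) / Q_n(w, z)` whose denominator has at least three distinct roots:
if `P, Q ∈ ℂ[z][w]` are coprime as polynomials in `w` over `ℂ(z)`, with
`deg_w P = n + 2`, `deg_w Q = n`, and `Q` has at least three pairwise distinct roots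
in an algebraic closure of `ℂ(z)`, then every single-valued solution of
`w' · Q(z, w) = P(z, w)` — every function meromorphic on all of `ℂ` satisfying the
equation at each point of analyticity — is a rational function. -/
theorem petrovic_generalized_riccati_three_roots
    (n : ℕ) (hn : 1 ≤ n)
    (P Q : Polynomial (Polynomial ℂ))
    (hcop : IsCoprime (P.map (algebraMap (Polynomial ℂ) (RatFunc ℂ)))
                      (Q.map (algebraMap (Polynomial ℂ) (RatFunc ℂ))))
    (hdegP : P.natDegree = n + 2) (hdegQ : Q.natDegree = n) (hQ : Q ≠ 0)
    (α β γ : AlgebraicClosure (RatFunc ℂ))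
    (hαβ : α ≠ β) (hαγ : α ≠ γ) (hβγ : β ≠ γ)
    (hα : Polynomial.aeval α (Q.map (algebraMap (Polynomial ℂ) (RatFunc ℂ))) = 0)
    (hβ : Polynomial.aeval β (Q.map (algebraMap (Polynomial ℂ) (RatFunc ℂ))) = 0)
    (hγ : Polynomial.aeval γ (Q.map (algebraMap (Polynomial ℂ) (RatFunc ℂ))) = 0)
    (w : ℂ → ℂ) (hw : MeromorphicOn w Set.univ)
    (hode : ∀ z : ℂ, AnalyticAt ℂ w z →
      deriv w z * evZW Q z (w z) = evZW P z (w z)) :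
    ∃ A B : Polynomial ℂ, B ≠ 0 ∧
      ∀ z : ℂ, AnalyticAt ℂ w z → w z * B.eval z = A.eval z := by
  exact pet_main n hn P Q hcop hdegQ hQ α β γ hαβ hαγ hβγ hα hβ hγ w hw hode
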